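/- arXiv:2002.02895 — 10 statements merged into one kernel-verified Lean document; each statement's English description precedes it below -/
import Mathlib

section
/- Let A and B be Hermitian complex n×n matrices and let f : ℝ → ℝ be continuously differentiable. Then the function t ↦ tr(f(A + t·B)) is differentiable at t = 0 with derivative tr(f'(A)·B), where f(A+tB) and f'(A) are defined by applying f and its derivative f' to the matrices via the continuous functional calculus (equivalently, by applying them to the eigenvalues in a spectral decomposition). -/
open Matrix

/-- Applying a real function `f` to a matrix via the continuous functional calculus:
for a Hermitian matrix `A` with spectral decomposition `A = ∑ i, λ i • E i`,
`matFun f A = ∑ i, f (λ i) • E i` (and `0` for non-Hermitian input). -/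
noncomputable def matFun (f : ℝ → ℝ) {ι : Type*} [Fintype ι] [DecidableEq ι]
    (A : Matrix ι ι ℂ) : Matrix ι ι ℂ :=
  if hA : A.IsHermitian then
    (Matrix.IsHermitian.eigenvectorUnitary hA : Matrix ι ι ℂ) *
      Matrix.diagonal (fun i => (f (hA.eigenvalues i) : ℂ)) *
      (star (Matrix.IsHermitian.eigenvectorUnitary hA) : Matrix ι ι ℂ)
  else 0

namespace TraceDeriv

lemma matFun_one {n : ℕ} {A : Matrix (Fin n) (Fin n) ℂ} (hA : A.IsHermitian) :
    matFun (fun _ => 1) A = 1 := by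
  simp only [matFun, dif_pos hA]
  have : (Matrix.diagonal (fun _ : Fin n => ((1:ℝ):ℂ))) = 1 := by simp
  rw [this, mul_one]
  exact Unitary.mul_star_self_of_mem hA.eigenvectorUnitary.2

lemma matFun_id {n : ℕ} {A : Matrix (Fin n) (Fin n) ℂ} (hA : A.IsHermitian) :
    matFun (fun x => x) A = A := by
  simp only [matFun, dif_pos hA]
  conv_rhs => rw [hA.spectral_theorem]
  rw [Unitary.conjStarAlgAut_apply]
  rfl

lemma matFun_mul {n : ℕ} {A : Matrix (Fin n) (Fin n) ℂ} (hA : A.IsHermitian) (g h : ℝ → ℝ) :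
    matFun g A * matFun h A = matFun (fun x => g x * h x) A := by
  simp only [matFun, dif_pos hA]
  have h1 : star (hA.eigenvectorUnitary : Matrix (Fin n) (Fin n) ℂ) * hA.eigenvectorUnitary = 1 :=
    Unitary.star_mul_self_of_mem hA.eigenvectorUnitary.2
  generalize (hA.eigenvectorUnitary : Matrix (Fin n) (Fin n) ℂ) = U at *
  have h2 : (Matrix.diagonal (fun i => ((g (hA.eigenvalues i) * h (hA.eigenvalues i) : ℝ) : ℂ)))
     = Matrix.diagonal (fun i => ((g (hA.eigenvalues i) : ℝ) : ℂ)) *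
       Matrix.diagonal (fun i => ((h (hA.eigenvalues i) : ℝ) : ℂ)) := by
    simp
  rw [h2]
  simp only [mul_assoc]
  rw [← mul_assoc (star U) U, h1, one_mul]

/-- trace pairing of functions of two Hermitian matrices. -/
lemma exists_weights {n : ℕ} {A M : Matrix (Fin n) (Fin n) ℂ} (hA : A.IsHermitian)
    (hM : M.IsHermitian) :
    ∃ p : Fin n → Fin n → ℝ, (∀ i j, 0 ≤ p i j) ∧ (∀ i, ∑ j, p i j = 1) ∧
      (∀ j, ∑ i, p i j = 1) ∧ ∀ g h : ℝ → ℝ, (matFun g A * matFun h M).trace =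
        ((∑ i, ∑ j, p i j * (g (hA.eigenvalues i) * h (hM.eigenvalues j)) : ℝ) : ℂ) := by
  have hU : (hA.eigenvectorUnitary : Matrix (Fin n) (Fin n) ℂ) ∈ Matrix.unitaryGroup (Fin n) ℂ :=
    hA.eigenvectorUnitary.2
  have hW : (hM.eigenvectorUnitary : Matrix (Fin n) (Fin n) ℂ) ∈ Matrix.unitaryGroup (Fin n) ℂ :=
    hM.eigenvectorUnitary.2
  simp only [matFun, dif_pos hA, dif_pos hM]
  generalize (hA.eigenvectorUnitary : Matrix (Fin n) (Fin n) ℂ) = U at *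
  generalize (hM.eigenvectorUnitary : Matrix (Fin n) (Fin n) ℂ) = W at *
  have hQ : star U * W ∈ Matrix.unitaryGroup (Fin n) ℂ := mul_mem (Unitary.star_mem hU) hW
  have hQs : star (star U * W) = star W * U := by simp
  generalize hQd : star U * W = Q at *
  refine ⟨fun i j => Complex.normSq (Q i j), fun i j => Complex.normSq_nonneg _, ?_, ?_, ?_⟩
  · intro i
    have h0 : Q * star Q = 1 := Unitary.mul_star_self_of_mem hQ
    have := congrArg (fun X : Matrix (Fin n) (Fin n) ℂ => X i i) h0
    simp only [Matrix.mul_apply, Matrix.star_apply, Matrix.one_apply_eq] at this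
    apply Complex.ofReal_injective
    push_cast
    rw [← this]
    exact Finset.sum_congr rfl fun j _ => by rw [← Complex.mul_conj]; rfl
  · intro j
    have h0 : star Q * Q = 1 := Unitary.star_mul_self_of_mem hQ
    have := congrArg (fun X : Matrix (Fin n) (Fin n) ℂ => X j j) h0
    simp only [Matrix.mul_apply, Matrix.star_apply, Matrix.one_apply_eq] at this
    apply Complex.ofReal_injective
    push_cast
    rw [← this]
    exact Finset.sum_congr rfl fun j _ => by rw [← Complex.mul_conj, mul_comm]; rfl
  · intro g h
    have e : ∀ D E : Matrix (Fin n) (Fin n) ℂ,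
        (U * D * star U * (W * E * star W)).trace = (D * (Q * (E * star Q))).trace := by
      intro D E
      rw [hQs, ← hQd]
      calc _ = (U * (D * star U * W * E * star W)).trace := by simp only [mul_assoc]
        _ = _ := by rw [Matrix.trace_mul_comm]; simp only [mul_assoc]
    rw [e]
    simp only [Matrix.trace, Matrix.diag_apply, Matrix.diagonal_mul]
    push_cast
    refine Finset.sum_congr rfl fun i _ => ?_
    rw [Matrix.mul_apply, Finset.mul_sum]
    refine Finset.sum_congr rfl fun j _ => ?_
    rw [Matrix.diagonal_mul, Matrix.star_apply, ← Complex.mul_conj]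
    simp only [RCLike.star_def]
    ring

lemma remainder_bound {f : ℝ → ℝ} (hf : Differentiable ℝ f) (R η a : ℝ) (hη : 0 < η) :
    ∃ C, 0 ≤ C ∧ ∀ x, |x| ≤ R →
      |f x - f a - deriv f a * (x - a)| ≤ η * |x - a| + C * (x - a) ^ 2 := by
  have h1 := (hasDerivAt_iff_isLittleO.1 (hf a).hasDerivAt).def hη
  obtain ⟨δ, hδ, h2⟩ := Metric.eventually_nhds_iff.1 h1
  have hc : ContinuousOn (fun x => f x - f a - deriv f a * (x - a)) (Set.Icc (-R) R) := by
    have := hf.continuous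
    fun_prop
  obtain ⟨K, hK⟩ := isCompact_Icc.exists_bound_of_continuousOn hc
  refine ⟨|K| / δ ^ 2, by positivity, fun x hx => ?_⟩
  by_cases hxa : |x - a| < δ
  · have := h2 (y := x) (by rwa [Real.dist_eq])
    simp only [Real.norm_eq_abs, smul_eq_mul] at this
    rw [mul_comm (deriv f a)]
    have h3 : 0 ≤ |K| / δ ^ 2 * (x - a) ^ 2 := by positivity
    linarith
  · push Not at hxa
    have h3 := hK x (abs_le.1 hx)
    rw [Real.norm_eq_abs] at h3
    have h4 : δ ^ 2 ≤ (x - a) ^ 2 := by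
      rw [← sq_abs (x - a)]; gcongr
    have h5 : |K| ≤ |K| / δ ^ 2 * (x - a) ^ 2 := by
      rw [div_mul_eq_mul_div, le_div_iff₀ (by positivity)]
      gcongr
    have h6 : 0 ≤ η * |x - a| := by positivity
    linarith [le_abs_self K]

lemma core {n : ℕ} {f : ℝ → ℝ} (hf : Differentiable ℝ f) (l : Fin n → ℝ) (S : ℝ) (hS : 0 ≤ S)
    (ε : ℝ) (hε : 0 < ε) :
    ∃ δ > 0, ∀ t : ℝ, |t| < δ → t ≠ 0 → ∀ (m : Fin n → ℝ) (p : Fin n → Fin n → ℝ),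
      (∀ i j, 0 ≤ p i j) → (∀ i, ∑ j, p i j = 1) → (∀ j, ∑ i, p i j = 1) →
      (∑ i, ∑ j, p i j * (m j - l i) ^ 2 = t ^ 2 * S) →
      |∑ i, ∑ j, p i j * (f (m j) - f (l i) - deriv f (l i) * (m j - l i))| ≤ ε * |t| := by
  set T : ℝ := 2 * S + 2 * ∑ i, l i ^ 2 with hT
  set η : ℝ := ε / (n + S + 1) with hη
  have hη0 : 0 < η := by positivity
  choose C hC0 hC using fun i => remainder_bound hf (T + 1) η (l i) hη0
  set D := ∑ i, C i with hD
  have hD0 : 0 ≤ D := Finset.sum_nonneg fun i _ => hC0 i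
  refine ⟨min 1 (ε / (2 * (D * S + 1))), by positivity, ?_⟩
  intro t ht ht0 m p hp hr hc hs
  have ht1 : |t| < 1 := ht.trans_le (min_le_left _ _)
  have ht2 : |t| < ε / (2 * (D * S + 1)) := ht.trans_le (min_le_right _ _)
  have htp : 0 < |t| := abs_pos.2 ht0
  have htsq : t ^ 2 ≤ 1 := by rw [← sq_abs]; nlinarith
  have hm : ∀ j, |m j| ≤ T + 1 := by
    intro j
    have h1 : ∑ i, p i j * (m j - l i) ^ 2 ≤ t ^ 2 * S := by
      rw [← hs, Finset.sum_comm]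
      exact Finset.single_le_sum (f := fun j => ∑ i, p i j * (m j - l i) ^ 2)
        (fun j _ => Finset.sum_nonneg fun i _ => mul_nonneg (hp i j) (sq_nonneg _))
        (Finset.mem_univ j)
    have h2 : ∑ i, p i j * l i ^ 2 ≤ ∑ i, l i ^ 2 := by
      refine Finset.sum_le_sum fun i _ => ?_
      have : p i j ≤ 1 := by
        rw [← hc j]
        exact Finset.single_le_sum (f := fun i => p i j) (fun i _ => hp i j) (Finset.mem_univ i)
      nlinarith [sq_nonneg (l i)]
    have h3 : m j ^ 2 ≤ ∑ i, (2 * (p i j * (m j - l i) ^ 2) + 2 * (p i j * l i ^ 2)) := by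
      calc m j ^ 2 = ∑ i, p i j * m j ^ 2 := by rw [← Finset.sum_mul, hc, one_mul]
        _ ≤ _ := by
          refine Finset.sum_le_sum fun i _ => ?_
          nlinarith [mul_nonneg (hp i j) (sq_nonneg (m j - 2 * l i))]
    rw [Finset.sum_add_distrib, ← Finset.mul_sum, ← Finset.mul_sum] at h3
    have h4 : m j ^ 2 ≤ T := by nlinarith
    rw [← sq_abs] at h4
    nlinarith [abs_nonneg (m j), sq_nonneg (|m j| - 1)]
  have hterm : ∀ i j, |p i j * (f (m j) - f (l i) - deriv f (l i) * (m j - l i))| ≤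
      p i j * (η * |t| / 2) + (η / (2 * |t|) + D) * (p i j * (m j - l i) ^ 2) := by
    intro i j
    rw [abs_mul, abs_of_nonneg (hp i j)]
    have h1 := hC i (m j) (hm j)
    have h2 : |m j - l i| ≤ |t| / 2 + (m j - l i) ^ 2 / (2 * |t|) := by
      rw [← sq_abs (m j - l i)]
      generalize |m j - l i| = x
      rw [← sub_nonneg]
      have : |t| / 2 + x ^ 2 / (2 * |t|) - x = (|t| - x) ^ 2 / (2 * |t|) := by
        field_simp
        ring
      rw [this]; positivity
    have h3 : C i ≤ D := Finset.single_le_sum (f := C) (fun i _ => hC0 i) (Finset.mem_univ i)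
    have h4 : η * |m j - l i| + C i * (m j - l i) ^ 2 ≤
        η * (|t| / 2 + (m j - l i) ^ 2 / (2 * |t|)) + D * (m j - l i) ^ 2 := by gcongr
    calc _ ≤ p i j * (η * (|t| / 2 + (m j - l i) ^ 2 / (2 * |t|)) + D * (m j - l i) ^ 2) :=
          mul_le_mul_of_nonneg_left (h1.trans h4) (hp i j)
      _ = _ := by ring
  calc _ ≤ ∑ i, ∑ j, (p i j * (η * |t| / 2) +
            (η / (2 * |t|) + D) * (p i j * (m j - l i) ^ 2)) :=
        (Finset.abs_sum_le_sum_abs _ _).trans (Finset.sum_le_sum fun i _ =>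
          (Finset.abs_sum_le_sum_abs _ _).trans (Finset.sum_le_sum fun j _ => hterm i j))
    _ = n * (η * |t| / 2) + (η / (2 * |t|) + D) * (t ^ 2 * S) := by
        simp only [Finset.sum_add_distrib, ← Finset.mul_sum, ← Finset.sum_mul, hr, hs]
        simp
    _ = (η * (n + S) / 2 + D * S * |t|) * |t| := by
        rw [← sq_abs t]; field_simp; ring
    _ ≤ ε * |t| := by
        refine mul_le_mul_of_nonneg_right ?_ htp.le
        have h1 : η * (n + S) ≤ ε := by
          have : η * (n + S + 1) = ε := by rw [hη]; field_simp
          linarith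
        have h2 : |t| * (2 * (D * S + 1)) < ε := (lt_div_iff₀ (by positivity)).1 ht2
        nlinarith

end TraceDeriv

open TraceDeriv in
/-- For Hermitian complex `n × n` matrices `A`, `B` and a continuously
differentiable function `f : ℝ → ℝ`, the map `t ↦ tr (f (A + t • B))` is differentiable
at `t = 0` with derivative `tr (f' (A) * B)`, where `f (A + t • B)` and `f' (A)` are
defined by the functional calculus. -/
theorem deriv_trace_matFun {n : ℕ} (A B : Matrix (Fin n) (Fin n) ℂ)
    (hA : A.IsHermitian) (hB : B.IsHermitian)
    (f : ℝ → ℝ) (hf : ContDiff ℝ 1 f) :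
    HasDerivAt (fun t : ℝ => (matFun f (A + t • B)).trace)
      ((matFun (deriv f) A * B).trace) 0 := by
  have hfd : Differentiable ℝ f := hf.differentiable (by norm_num)
  obtain ⟨S, hS0, hS⟩ : ∃ S : ℝ, 0 ≤ S ∧ (B * B).trace = (S : ℂ) := by
    have h1 : (B * B).trace = ((∑ i, ∑ j, Complex.normSq (B i j) : ℝ) : ℂ) := by
      simp only [Matrix.trace, Matrix.diag_apply, Matrix.mul_apply]
      push_cast
      refine Finset.sum_congr rfl fun i _ => Finset.sum_congr rfl fun j _ => ?_
      rw [← Complex.mul_conj, ← hB.apply j i]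
      rfl
    exact ⟨_, Finset.sum_nonneg fun i _ => Finset.sum_nonneg fun j _ =>
      Complex.normSq_nonneg _, h1⟩
  rw [hasDerivAt_iff_isLittleO, Asymptotics.isLittleO_iff]
  intro ε hε
  obtain ⟨δ, hδ, H⟩ := core hfd hA.eigenvalues S hS0 ε hε
  rw [Metric.eventually_nhds_iff]
  refine ⟨δ, hδ, fun t ht => ?_⟩
  rw [Real.dist_eq, sub_zero] at ht
  rcases eq_or_ne t 0 with rfl | ht0
  · simp
  have hM : (A + t • B).IsHermitian := hA.add (by
    rw [Matrix.IsHermitian, Matrix.conjTranspose_smul, hB.eq]; simp)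
  change ‖(matFun f (A + t • B)).trace - (matFun f (A + (0 : ℝ) • B)).trace -
      (t - 0) • (matFun (deriv f) A * B).trace‖ ≤ _
  generalize hMd : A + t • B = M at hM ⊢
  obtain ⟨p, hp, hr, hc, hp4⟩ := exists_weights hA hM
  have eM := matFun_id hM
  have eA := matFun_id hA
  have eM1 := matFun_one hM
  have eA1 := matFun_one hA
  have k1 : ∀ h : ℝ → ℝ, (matFun h M).trace =
      ((∑ i, ∑ j, p i j * h (hM.eigenvalues j) : ℝ) : ℂ) := by
    intro h
    have := hp4 (fun _ => 1) h
    simpa only [eA1, one_mul] using this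
  have k2 : ∀ h : ℝ → ℝ, (matFun h A).trace =
      ((∑ i, ∑ j, p i j * h (hA.eigenvalues i) : ℝ) : ℂ) := by
    intro h
    have := hp4 h (fun _ => 1)
    simpa only [eM1, mul_one] using this
  have k3 := hp4 (deriv f) (fun x => x)
  rw [eM] at k3
  have k4 := k2 (fun x => deriv f x * x)
  rw [← matFun_mul hA (deriv f) (fun x => x), eA] at k4
  have k5 := hp4 (fun x => x) (fun x => x)
  rw [eM, eA] at k5
  have k6 := k2 (fun x => x * x)
  rw [← matFun_mul hA (fun x => x) (fun x => x), eA] at k6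
  have k7 := k1 (fun x => x * x)
  rw [← matFun_mul hM (fun x => x) (fun x => x), eM] at k7
  have htB : (t : ℂ) • B = M - A := by rw [← hMd]; ext i j; simp
  have hs : ∑ i, ∑ j, p i j * (hM.eigenvalues j - hA.eigenvalues i) ^ 2 = t ^ 2 * S := by
    apply Complex.ofReal_injective
    have e1 : (((t : ℂ) • B) * ((t : ℂ) • B)).trace = ((t ^ 2 * S : ℝ) : ℂ) := by
      rw [smul_mul_smul_comm, Matrix.trace_smul, hS]; push_cast; rw [smul_eq_mul]; ring
    rw [← e1, htB]
    have e2 : ((M - A) * (M - A)).trace = (M * M).trace - 2 * (A * M).trace + (A * A).trace := by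
      rw [sub_mul, mul_sub, mul_sub]
      simp only [Matrix.trace_sub]
      rw [Matrix.trace_mul_comm M A]; ring
    rw [e2, k5, k6, k7]
    norm_cast
    simp only [Finset.mul_sum, ← Finset.sum_sub_distrib, ← Finset.sum_add_distrib]
    exact Finset.sum_congr rfl fun i _ => Finset.sum_congr rfl fun j _ => by ring
  have key := H t ht ht0 hM.eigenvalues p hp hr hc hs
  have e3 : (t : ℂ) * (matFun (deriv f) A * B).trace =
      (matFun (deriv f) A * M).trace - (matFun (deriv f) A * A).trace := by
    rw [← Matrix.trace_sub, ← mul_sub, ← htB, mul_smul_comm, Matrix.trace_smul, smul_eq_mul]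
  have e4 : (matFun f M).trace - (matFun f (A + (0 : ℝ) • B)).trace -
      (t - 0) • (matFun (deriv f) A * B).trace =
      ((∑ i, ∑ j, p i j * (f (hM.eigenvalues j) - f (hA.eigenvalues i) -
        deriv f (hA.eigenvalues i) * (hM.eigenvalues j - hA.eigenvalues i)) : ℝ) : ℂ) := by
    rw [zero_smul, add_zero, sub_zero, Complex.real_smul, e3, k1, k2, k3, k4]
    norm_cast
    simp only [← Finset.sum_sub_distrib]
    exact Finset.sum_congr rfl fun i _ => Finset.sum_congr rfl fun j _ => by ring
  rw [e4, Complex.norm_real, Real.norm_eq_abs, Real.norm_eq_abs, sub_zero]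
  exact key
end

section
/- Let F be the function on the real vector space of Hermitian complex n×n matrices given on positive definite matrices by F(X) = tr(X log X). Then for all positive definite Hermitian matrices ρ and σ, the Bregman divergence of F equals the information divergence: F(ρ) − F(σ) − (DF(σ))(ρ − σ) = tr(ρ(log ρ − log σ)) − tr(ρ − σ), where DF(σ) is the Fréchet derivative of F at σ (within the set of positive definite Hermitian matrices, which is open in the real vector space of Hermitian matrices). -/
open Matrix
open scoped ComplexOrder

attribute [local instance] Matrix.frobeniusNormedAddCommGroup Matrix.frobeniusNormedSpace

/-- The matrix logarithm via the continuous functional calculus. -/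
noncomputable def matLog {ι : Type*} [Fintype ι] [DecidableEq ι]
    (A : Matrix ι ι ℂ) : Matrix ι ι ℂ :=
  matFun Real.log A

/-- `F X = tr (X log X)` (as a real number). -/
noncomputable def negEntropy {ι : Type*} [Fintype ι] [DecidableEq ι]
    (X : Matrix ι ι ℂ) : ℝ :=
  ((X * matLog X).trace).re


lemma aux_herm_decomp {n : ℕ} {A : Matrix (Fin n) (Fin n) ℂ} (hA : A.IsHermitian) :
    ∃ (U : Matrix (Fin n) (Fin n) ℂ), U * Uᴴ = 1 ∧ Uᴴ * U = 1 ∧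
      A = U * diagonal (fun i => (hA.eigenvalues i : ℂ)) * Uᴴ ∧
      matLog A = U * diagonal (fun i => (Real.log (hA.eigenvalues i) : ℂ)) * Uᴴ := by
  refine ⟨hA.eigenvectorUnitary, ?_, ?_, ?_, ?_⟩
  · exact Unitary.coe_mul_star_self hA.eigenvectorUnitary
  · exact Unitary.coe_star_mul_self hA.eigenvectorUnitary
  · have h := hA.spectral_theorem
    rw [Unitary.conjStarAlgAut_apply] at h
    exact h
  · rw [matLog, matFun, dif_pos hA]
    rfl

lemma aux_psd_shift {n : ℕ} {A U : Matrix (Fin n) (Fin n) ℂ} {e : Fin n → ℝ} (c : ℝ)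
    (hU : U * Uᴴ = 1) (hA : A = U * diagonal (fun i => (e i : ℂ)) * Uᴴ)
    (h : ∀ i, 0 ≤ e i + c) : (A + c • (1 : Matrix (Fin n) (Fin n) ℂ)).PosSemidef := by
  have : A + c • (1 : Matrix (Fin n) (Fin n) ℂ)
      = U * diagonal (fun i => ((e i + c : ℝ) : ℂ)) * Uᴴ := by
    have h1 : diagonal (fun i => ((e i + c : ℝ) : ℂ))
        = diagonal (fun i => (e i : ℂ)) + c • (1 : Matrix (Fin n) (Fin n) ℂ) := by
      ext i j
      by_cases hij : i = j <;> simp [hij]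
    rw [h1, Matrix.mul_add, Matrix.add_mul, ← hA, Matrix.mul_smul, Matrix.smul_mul, Matrix.mul_one,
      hU]
  rw [this]
  apply PosSemidef.mul_mul_conjTranspose_same
  rw [posSemidef_diagonal_iff]
  intro i
  exact_mod_cast h i

lemma aux_open {n : ℕ} {σ A : Matrix (Fin n) (Fin n) ℂ} (hσ : σ.PosDef) (hA : A.IsHermitian) :
    ∃ ε > (0 : ℝ), ∀ t : ℝ, 0 < t → t < ε → (σ + t • A).PosDef := by
  obtain ⟨U, hU, -, hAU, -⟩ := aux_herm_decomp hA
  obtain ⟨V, hV, -, hσV, -⟩ := aux_herm_decomp hσ.1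
  have hpos := hσ.eigenvalues_pos
  obtain ⟨c, hc, hc'⟩ : ∃ c > (0 : ℝ), ∀ i, c ≤ hσ.1.eigenvalues i := by
    rcases isEmpty_or_nonempty (Fin n) with h | h
    · exact ⟨1, one_pos, fun i => h.elim i⟩
    · obtain ⟨i, hi⟩ := Finite.exists_min hσ.1.eigenvalues
      exact ⟨_, hpos i, hi⟩
  set C : ℝ := 1 + ∑ i, |hA.eigenvalues i| with hC
  have hC0 : 0 < C := by positivity
  have h1 := aux_psd_shift (-c) hV hσV (fun i => by linarith [hc' i])
  have h2 := aux_psd_shift C hU hAU (fun i => by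
    have := Finset.single_le_sum (f := fun i => |hA.eigenvalues i|) (fun i _ => abs_nonneg _)
      (Finset.mem_univ i)
    have := neg_abs_le (hA.eigenvalues i)
    linarith)
  refine ⟨c / C, by positivity, fun t ht0 ht => ?_⟩
  have ht' : 0 < c - t * C := by
    rw [lt_div_iff₀ hC0] at ht
    linarith
  have h3 : ((c - t * C) • (1 : Matrix (Fin n) (Fin n) ℂ)).PosDef := PosDef.one.smul ht'
  have h4 := (h3.add_posSemidef (h2.smul ht0.le)).add_posSemidef h1
  convert h4 using 1
  module

lemma aux_trace {n : ℕ} (U V : Matrix (Fin n) (Fin n) ℂ) (f g : Fin n → ℝ) :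
    ((U * diagonal (fun i => (f i : ℂ)) * Uᴴ * (V * diagonal (fun i => (g i : ℂ)) * Vᴴ)).trace).re
      = ∑ i, ∑ j, f i * g j * Complex.normSq ((Uᴴ * V) i j) := by
  have h : (U * diagonal (fun i => (f i : ℂ)) * Uᴴ *
      (V * diagonal (fun i => (g i : ℂ)) * Vᴴ)).trace
      = (diagonal (fun i => (f i : ℂ)) * ((Uᴴ * V) * diagonal (fun i => (g i : ℂ))
        * (Uᴴ * V)ᴴ)).trace := by
    rw [Matrix.mul_assoc U, Matrix.mul_assoc U, Matrix.trace_mul_comm U]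
    simp only [conjTranspose_mul, conjTranspose_conjTranspose, Matrix.mul_assoc]
  rw [h]
  generalize Uᴴ * V = W
  simp only [Matrix.trace, Matrix.diag_apply, Matrix.diagonal_mul]
  rw [Complex.re_sum]
  refine Finset.sum_congr rfl fun i _ => ?_
  rw [Matrix.mul_apply, Finset.mul_sum, Complex.re_sum]
  refine Finset.sum_congr rfl fun j _ => ?_
  rw [Matrix.mul_diagonal, conjTranspose_apply]
  have : (f i : ℂ) * (W i j * (g j : ℂ) * star (W i j))
      = ((f i * g j * Complex.normSq (W i j) : ℝ) : ℂ) := by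
    push_cast
    rw [← Complex.mul_conj]
    simp only [Complex.star_def]
    ring
  rw [this, Complex.ofReal_re]

lemma aux_scalar {a b : ℝ} (ha : 0 < a) (hb : 0 < b) :
    0 ≤ a * Real.log a - a * Real.log b - a + b := by
  have h := Real.log_le_sub_one_of_pos (div_pos hb ha)
  rw [Real.log_div hb.ne' ha.ne'] at h
  have h2 := mul_le_mul_of_nonneg_left h ha.le
  have h3 : a * (b / a - 1) = b - a := by field_simp
  linarith

lemma aux_klein {n : ℕ} {X σ : Matrix (Fin n) (Fin n) ℂ} (hX : X.PosDef) (hσ : σ.PosDef) :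
    0 ≤ ((X * matLog X).trace).re - ((X * matLog σ).trace).re - (X.trace).re + (σ.trace).re := by
  obtain ⟨U, hU, hU', hXU, hXl⟩ := aux_herm_decomp hX.1
  obtain ⟨V, hV, hV', hσV, hσl⟩ := aux_herm_decomp hσ.1
  have ha := hX.eigenvalues_pos
  have hb := hσ.eigenvalues_pos
  set a := hX.1.eigenvalues
  set b := hσ.1.eigenvalues
  have hV1 : V * diagonal (fun i => (((fun _ => 1 : Fin n → ℝ) i : ℝ) : ℂ)) * Vᴴ = 1 := by
    simp [hV]
  have hU1 : U * diagonal (fun i => (((fun _ => 1 : Fin n → ℝ) i : ℝ) : ℂ)) * Uᴴ = 1 := by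
    simp [hU]
  have e1 : X * matLog X = U * diagonal (fun i => ((a i * Real.log (a i) : ℝ) : ℂ)) * Uᴴ := by
    rw [hXl]
    conv_lhs => rw [hXU]
    calc _ = U * diagonal (fun i => (a i : ℂ)) * (Uᴴ * U)
          * diagonal (fun i => (Real.log (a i) : ℂ)) * Uᴴ := by simp only [Matrix.mul_assoc]
      _ = _ := by
        rw [hU', Matrix.mul_one, Matrix.mul_assoc U, diagonal_mul_diagonal]
        simp only [Complex.ofReal_mul]
  have t1 := aux_trace U V (fun i => a i * Real.log (a i)) (fun _ => 1)
  have t2 := aux_trace U V a (fun j => Real.log (b j))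
  have t3 := aux_trace U V a (fun _ => 1)
  have t4 := aux_trace U V (fun _ => 1) b
  rw [hV1, Matrix.mul_one, ← e1] at t1
  rw [← hXU, ← hσl] at t2
  rw [hV1, Matrix.mul_one, ← hXU] at t3
  rw [hU1, Matrix.one_mul, ← hσV] at t4
  rw [t1, t2, t3, t4]
  simp only [← Finset.sum_sub_distrib, ← Finset.sum_add_distrib]
  refine Finset.sum_nonneg fun i _ => Finset.sum_nonneg fun j _ => ?_
  have := mul_nonneg (aux_scalar (ha i) (hb j)) (Complex.normSq_nonneg ((Uᴴ * V) i j))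
  linarith

theorem bregman_negEntropy_eq_relEntropy {n : ℕ}
    (ρ σ : Matrix (Fin n) (Fin n) ℂ)
    (hρ : ρ.PosDef) (hσ : σ.PosDef)
    (L : Matrix (Fin n) (Fin n) ℂ →L[ℝ] ℝ)
    (hL : HasFDerivWithinAt negEntropy L
      {X : Matrix (Fin n) (Fin n) ℂ | X.IsHermitian ∧ X.PosDef} σ) :
    negEntropy ρ - negEntropy σ - L (ρ - σ) =
      ((ρ * (matLog ρ - matLog σ)).trace).re - ((ρ - σ).trace).re := by
  let M₀ : Matrix (Fin n) (Fin n) ℂ →ₗ[ℝ] ℝ :=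
    { toFun := fun X => ((X * matLog σ).trace).re + (X.trace).re
      map_add' := fun X Y => by
        simp only [Matrix.add_mul, Matrix.trace_add, Complex.add_re]
        ring
      map_smul' := fun c X => by
        simp only [Matrix.smul_mul, Matrix.trace_smul, Complex.smul_re, smul_eq_mul,
          RingHom.id_apply]
        ring }
  let M : Matrix (Fin n) (Fin n) ℂ →L[ℝ] ℝ := LinearMap.toContinuousLinearMap M₀
  have hM : ∀ X, M X = ((X * matLog σ).trace).re + (X.trace).re := fun X => rfl
  have hD := hL.sub M.hasFDerivWithinAt
  have hmin : IsLocalMinOn (negEntropy - ⇑M)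
      {X : Matrix (Fin n) (Fin n) ℂ | X.IsHermitian ∧ X.PosDef} σ := by
    apply IsMinOn.localize
    intro X hX
    have := aux_klein hX.2 hσ
    simp only [Set.mem_ofPred_eq, Pi.sub_apply, hM, negEntropy]
    linarith
  have hcone : ∀ A : Matrix (Fin n) (Fin n) ℂ, A.IsHermitian → A ∈ posTangentConeAt
      {X : Matrix (Fin n) (Fin n) ℂ | X.IsHermitian ∧ X.PosDef} σ := by
    intro A hA
    obtain ⟨ε, hε, h⟩ := aux_open hσ hA
    apply mem_posTangentConeAt_of_frequently_mem
    apply Filter.Eventually.frequently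
    filter_upwards [Ioo_mem_nhdsGT hε] with t ht
    have := h t ht.1 ht.2
    exact ⟨this.1, this⟩
  have hH : (ρ - σ).IsHermitian := hρ.1.sub hσ.1
  have h0 := hmin.hasFDerivWithinAt_eq_zero hD (hcone _ hH) (hcone _ hH.neg)
  have h1 : L (ρ - σ) = M (ρ - σ) := by
    have h0 : L (ρ - σ) - M (ρ - σ) = 0 := h0
    linarith
  rw [h1, hM]
  simp only [negEntropy, Matrix.mul_sub, Matrix.sub_mul, Matrix.trace_sub, Complex.sub_re]
  ring
end

section
/- Let ρ, σ₁, σ₂ be density matrices (complex n×n) with ρ·σ₁ = 0 and ρ·σ₂ = 0 (mutual singularity), and let t ∈ [0, 1). Then D(ρ ‖ (1−t)·ρ + t·σ₁) = D(ρ ‖ (1−t)·ρ + t·σ₂) = −log(1−t). In particular the quantum information divergence satisfies statistical locality: the value does not depend on which state σᵢ singular to ρ is mixed in. -/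
open Matrix
open scoped ComplexOrder

/-- Quantum relative entropy (information divergence) `D(ρ‖σ) = tr (ρ (log ρ - log σ))`. -/
noncomputable def qRelEnt {ι : Type*} [Fintype ι] [DecidableEq ι]
    (ρ σ : Matrix ι ι ℂ) : ℝ :=
  ((ρ * (matLog ρ - matLog σ)).trace).re

theorem matLog_eq_cfc {n : ℕ} {A : Matrix (Fin n) (Fin n) ℂ} (hA : A.IsHermitian) :
    matLog A = cfc Real.log A := by
  rw [hA.cfc_eq, matLog, matFun, dif_pos hA, Matrix.IsHermitian.cfc,
    Unitary.conjStarAlgAut_apply]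
  rfl

theorem mul_aeval_eq {n : ℕ} (ρ M N : Matrix (Fin n) (Fin n) ℂ)
    (h : ρ * M = ρ * N) (hc : Commute ρ N) (q : Polynomial ℝ) :
    ρ * Polynomial.aeval M q = ρ * Polynomial.aeval N q := by
  have hpow : ∀ k : ℕ, ρ * M ^ k = ρ * N ^ k := by
    intro k
    induction k with
    | zero => simp
    | succ k ih =>
      rw [pow_succ, ← mul_assoc, ih, (hc.pow_right k).eq, mul_assoc, h, ← mul_assoc,
        ← (hc.pow_right k).eq, mul_assoc, ← pow_succ]
  rw [Polynomial.aeval_eq_sum_range, Polynomial.aeval_eq_sum_range, Finset.mul_sum,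
    Finset.mul_sum]
  refine Finset.sum_congr rfl fun k _ => ?_
  rw [mul_smul_comm, mul_smul_comm, hpow]

theorem qRelEnt_one {n : ℕ} (ρ σ : Matrix (Fin n) (Fin n) ℂ)
    (hρ : ρ.IsHermitian) (hρtr : ρ.trace = 1) (hσ : σ.IsHermitian) (hs : ρ * σ = 0)
    (t : ℝ) (ht1 : t < 1) :
    qRelEnt ρ ((1 - t) • ρ + t • σ) = -Real.log (1 - t) := by
  have hc : (1 - t) ≠ 0 := by linarith
  generalize 1 - t = c at hc ⊢
  have hN : (c • ρ).IsHermitian := by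
    simp [Matrix.IsHermitian, Matrix.conjTranspose_smul, hρ.eq]
  have hM : (c • ρ + t • σ).IsHermitian := by
    simp [Matrix.IsHermitian, Matrix.conjTranspose_smul, hρ.eq, hσ.eq]
  set M := c • ρ + t • σ with hMdef
  have hρ' : IsSelfAdjoint ρ := hρ
  have hM' : IsSelfAdjoint M := hM
  have hN' : IsSelfAdjoint (c • ρ) := hN
  have hρM : ρ * M = ρ * (c • ρ) := by
    rw [hMdef, mul_add, mul_smul_comm t, hs, smul_zero, add_zero]
  have hcomm : Commute ρ (c • ρ) := (Commute.refl ρ).smul_right c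
  have hfM : (spectrum ℝ M).Finite := Matrix.finite_real_spectrum
  have hfN : (spectrum ℝ (c • ρ)).Finite := Matrix.finite_real_spectrum
  have hfρ : (spectrum ℝ ρ).Finite := Matrix.finite_real_spectrum
  have hq : ∃ q : Polynomial ℝ, ∀ x ∈ spectrum ℝ M ∪ spectrum ℝ (c • ρ),
      q.eval x = Real.log x := by
    refine ⟨Lagrange.interpolate (hfM.union hfN).toFinset id Real.log, fun x hx => ?_⟩
    exact Lagrange.eval_interpolate_at_node (v := id) Real.log Function.injective_id.injOn
      ((hfM.union hfN).mem_toFinset.2 hx)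
  obtain ⟨q, hq⟩ := hq
  have hlogM : matLog M = Polynomial.aeval M q := by
    rw [matLog_eq_cfc hM, ← cfc_polynomial q M hM']
    exact cfc_congr fun x hx => (hq x (Or.inl hx)).symm
  have hlogN : cfc Real.log (c • ρ) = Polynomial.aeval (c • ρ) q := by
    rw [← cfc_polynomial q (c • ρ) hN']
    exact cfc_congr fun x hx => (hq x (Or.inr hx)).symm
  have hco : ∀ f : ℝ → ℝ, ContinuousOn f (spectrum ℝ ρ) := fun f => hfρ.continuousOn f
  have hlogN2 : cfc Real.log (c • ρ) = cfc (fun x => Real.log (c * x)) ρ := by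
    rw [← cfc_comp_const_mul c Real.log ρ
      ((hfρ.image _).continuousOn _) hρ']
  have hmul : ∀ f : ℝ → ℝ, ρ * cfc f ρ = cfc (fun x => x * f x) ρ := by
    intro f
    rw [cfc_mul (fun x => x) f ρ (hco _) (hco _), cfc_id' ℝ ρ hρ']
  have key : ρ * matLog M = Real.log c • ρ + ρ * matLog ρ := by
    rw [hlogM, mul_aeval_eq ρ M (c • ρ) hρM hcomm, ← hlogN, hlogN2, matLog_eq_cfc hρ,
      hmul, hmul]
    have : Real.log c • ρ = cfc (fun x => Real.log c * x) ρ := by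
      rw [cfc_const_mul_id (Real.log c) ρ hρ']
    rw [this, ← cfc_add _ _ _ (hco _) (hco _)]
    congr 1
    funext x
    by_cases hx : x = 0
    · simp [hx]
    · rw [Real.log_mul hc hx]; ring
  rw [qRelEnt, mul_sub, key, sub_add_cancel_right, Matrix.trace_neg, Matrix.trace_smul, hρtr]
  simp

/-- statistical locality of the quantum information divergence.
If `ρ, σ₁, σ₂` are density matrices with `ρ * σ₁ = 0` and `ρ * σ₂ = 0`
(mutual singularity) and `t ∈ [0, 1)`, then
`D(ρ ‖ (1-t)ρ + tσ₁) = D(ρ ‖ (1-t)ρ + tσ₂) = -log (1-t)`. -/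
theorem qRelEnt_statistical_locality {n : ℕ}
    (ρ σ₁ σ₂ : Matrix (Fin n) (Fin n) ℂ)
    (hρ : ρ.PosSemidef) (hρtr : ρ.trace = 1)
    (hσ₁ : σ₁.PosSemidef) (hσ₁tr : σ₁.trace = 1)
    (hσ₂ : σ₂.PosSemidef) (hσ₂tr : σ₂.trace = 1)
    (hsing₁ : ρ * σ₁ = 0) (hsing₂ : ρ * σ₂ = 0)
    (t : ℝ) (ht0 : 0 ≤ t) (ht1 : t < 1) :
    qRelEnt ρ ((1 - t) • ρ + t • σ₁) = -Real.log (1 - t) ∧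
    qRelEnt ρ ((1 - t) • ρ + t • σ₂) = -Real.log (1 - t) := by
  exact ⟨qRelEnt_one ρ σ₁ hρ.1 hρtr hσ₁.1 hsing₁ t ht1,
    qRelEnt_one ρ σ₂ hρ.1 hρtr hσ₂.1 hsing₂ t ht1⟩
end

section
/- Let σ be a complex n×n density matrix and suppose σ = ∑ᵢ₌₁^m pᵢ·σᵢ where (p₁,…,pₘ) is a probability vector and each σᵢ is a pure state (a rank-one orthogonal projection, i.e., a Hermitian idempotent of trace 1). Then the Shannon entropy of the mixing distribution dominates the von Neumann entropy: H(p₁,…,pₘ) ≥ S(σ). -/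
open Matrix
open scoped ComplexOrder

/-- Von Neumann entropy `S(σ) = -tr (σ log σ)`, with the convention `0 log 0 = 0`. -/
noncomputable def vnEntropy {ι : Type*} [Fintype ι] [DecidableEq ι]
    (σ : Matrix ι ι ℂ) : ℝ :=
  -((σ * matFun Real.log σ).trace).re

/-- Shannon entropy of a probability vector, with the convention `0 log 0 = 0`. -/
noncomputable def shannonEntropy {m : ℕ} (p : Fin m → ℝ) : ℝ :=
  -∑ i, p i * Real.log (p i)


lemma aux_sub {m n : ℕ} (V : Fin m → Fin n → ℂ) (l : Fin n → ℝ) (p : Fin m → ℝ)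
    (hl : ∀ j, 0 ≤ l j) (hp : ∀ i, 0 ≤ p i)
    (h : ∀ j k, ∑ i, (p i : ℂ) * (V i j * star (V i k)) = if j = k then (l j : ℂ) else 0)
    (i : Fin m) : ∑ j, p i * Complex.normSq (V i j) * (l j)⁻¹ ≤ 1 := by
  set c : ℝ := ∑ j, Complex.normSq (V i j) * (l j)⁻¹ with hc
  have hc0 : 0 ≤ c := Finset.sum_nonneg fun j _ =>
    mul_nonneg (Complex.normSq_nonneg _) (inv_nonneg.2 (hl j))
  have e1 : ∑ j, p i * Complex.normSq (V i j) * (l j)⁻¹ = p i * c := by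
    rw [hc, Finset.mul_sum]; exact Finset.sum_congr rfl fun j _ => by ring
  rw [e1]
  let x : Fin n → ℂ := fun j => V i j * ((l j)⁻¹ : ℝ)
  have key : ∑ i', p i' * Complex.normSq (∑ j, star (x j) * V i' j) = c := by
    have : ((∑ i', p i' * Complex.normSq (∑ j, star (x j) * V i' j) : ℝ) : ℂ) = (c : ℂ) := by
      push_cast
      calc ∑ i', (p i' : ℂ) * (Complex.normSq (∑ j, star (x j) * V i' j) : ℂ)
          = ∑ i', ∑ j, ∑ k, star (x j) * x k * ((p i' : ℂ) * (V i' j * star (V i' k))) := by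
            refine Finset.sum_congr rfl fun i' _ => ?_
            rw [← Complex.mul_conj, map_sum, Finset.sum_mul_sum, Finset.mul_sum]
            refine Finset.sum_congr rfl fun j _ => ?_
            rw [Finset.mul_sum]
            refine Finset.sum_congr rfl fun k _ => ?_
            simp only [map_mul, ← starRingEnd_apply, Complex.conj_conj]
            ring
        _ = ∑ j, ∑ k, star (x j) * x k * (if j = k then (l j : ℂ) else 0) := by
            rw [Finset.sum_comm]
            refine Finset.sum_congr rfl fun j _ => ?_
            rw [Finset.sum_comm]
            refine Finset.sum_congr rfl fun k _ => ?_
            rw [← Finset.mul_sum, h]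
        _ = (c : ℂ) := by
            rw [hc]
            push_cast
            refine Finset.sum_congr rfl fun j _ => ?_
            simp only [mul_ite, mul_zero, Finset.sum_ite_eq, Finset.mem_univ, if_true, x]
            rw [← Complex.mul_conj]
            simp only [← starRingEnd_apply, map_mul, Complex.conj_ofReal]
            push_cast
            by_cases h0 : (l j : ℂ) = 0
            · simp [h0]
            · field_simp
    exact_mod_cast this
  have hi : ∑ j, star (x j) * V i j = (c : ℂ) := by
    rw [hc]; push_cast
    refine Finset.sum_congr rfl fun j _ => ?_
    simp only [x]
    rw [← Complex.mul_conj]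
    simp only [← starRingEnd_apply, map_mul, Complex.conj_ofReal]
    push_cast; ring
  have h2 : p i * (c * c) ≤ c := by
    have := Finset.single_le_sum (f := fun i' => p i' * Complex.normSq (∑ j, star (x j) * V i' j))
      (fun i' _ => mul_nonneg (hp i') (Complex.normSq_nonneg _)) (Finset.mem_univ i)
    simp only [hi, key, Complex.normSq_ofReal] at this
    exact this
  rcases hc0.eq_or_lt with h0 | h0
  · rw [← h0]; simp
  · by_contra hcon
    nlinarith

lemma aux_main {m n : ℕ} (V : Fin m → Fin n → ℂ) (l : Fin n → ℝ) (p : Fin m → ℝ)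
    (hl : ∀ j, 0 ≤ l j) (hp : ∀ i, 0 ≤ p i)
    (h : ∀ j k, ∑ i, (p i : ℂ) * (V i j * star (V i k)) = if j = k then (l j : ℂ) else 0)
    (hV : ∀ i, ∑ j, Complex.normSq (V i j) = 1) :
    ∑ j, Real.negMulLog (l j) ≤ ∑ i, Real.negMulLog (p i) := by
  have hdiag : ∀ j, ∑ i, p i * Complex.normSq (V i j) = l j := by
    intro j
    have := h j j
    simp only [if_true, ← starRingEnd_apply, Complex.mul_conj] at this
    exact_mod_cast this
  let B : Fin m → Fin n → ℝ := fun i j => p i * Complex.normSq (V i j) * (l j)⁻¹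
  have hB : ∀ i j, 0 ≤ B i j := fun i j =>
    mul_nonneg (mul_nonneg (hp i) (Complex.normSq_nonneg _)) (inv_nonneg.2 (hl j))
  have hBl : ∀ i j, B i j * l j = p i * Complex.normSq (V i j) := by
    intro i j
    by_cases h0 : l j = 0
    · have h1 := hdiag j
      rw [h0, Finset.sum_eq_zero_iff_of_nonneg
        (fun i _ => mul_nonneg (hp i) (Complex.normSq_nonneg _))] at h1
      rw [h1 i (Finset.mem_univ _), h0, mul_zero]
    · simp only [B]; field_simp
  have hstep : ∀ i, ∑ j, B i j * Real.negMulLog (l j) ≤ Real.negMulLog (p i) := by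
    intro i
    have hs := aux_sub V l p hl hp h i
    have := Real.concaveOn_negMulLog.le_map_sum (t := (Finset.univ : Finset (Option (Fin n))))
      (w := fun o => o.elim (1 - ∑ j, B i j) (B i)) (p := fun o => o.elim 0 l)
      (by rintro (_ | j) _
          · simpa [B] using hs
          · exact hB i j)
      (by simp [Fintype.sum_option])
      (by rintro (_ | j) _
          · simp
          · exact hl j)
    simp only [Fintype.sum_option, Option.elim, smul_eq_mul, Real.negMulLog_zero, mul_zero,
      zero_add, hBl, ← Finset.mul_sum, hV, mul_one] at this
    exact this
  calc ∑ j, Real.negMulLog (l j) = ∑ j, ∑ i, B i j * Real.negMulLog (l j) := by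
        refine Finset.sum_congr rfl fun j _ => ?_
        by_cases h0 : l j = 0
        · simp [h0]
        · rw [← Finset.sum_mul]
          simp only [B]
          rw [← Finset.sum_mul, hdiag, mul_inv_cancel₀ h0, one_mul]
    _ = ∑ i, ∑ j, B i j * Real.negMulLog (l j) := Finset.sum_comm
    _ ≤ _ := Finset.sum_le_sum fun i _ => hstep i

lemma aux_diag {n : ℕ} (A : Matrix (Fin n) (Fin n) ℂ) (hA : A.IsHermitian) :
    star (hA.eigenvectorUnitary : Matrix (Fin n) (Fin n) ℂ) * A *
      (hA.eigenvectorUnitary : Matrix (Fin n) (Fin n) ℂ)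
      = diagonal (fun i => (hA.eigenvalues i : ℂ)) := by
  have := hA.conjStarAlgAut_star_eigenvectorUnitary
  rw [Unitary.conjStarAlgAut_star_apply] at this
  exact this

lemma aux_pure {n : ℕ} (T : Matrix (Fin n) (Fin n) ℂ) (hT : T.IsHermitian)
    (hi : T * T = T) (htr : T.trace = 1) :
    ∃ v : Fin n → ℂ, ∀ a b, T a b = v a * star (v b) := by
  set U : Matrix (Fin n) (Fin n) ℂ := (hT.eigenvectorUnitary : Matrix (Fin n) (Fin n) ℂ) with hU
  have hUU : star U * U = 1 := Unitary.coe_star_mul_self hT.eigenvectorUnitary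
  have hUU' : U * star U = 1 := Unitary.coe_mul_star_self hT.eigenvectorUnitary
  have hd := aux_diag T hT
  rw [← hU] at hd
  have hTe : T = U * diagonal (fun i => (hT.eigenvalues i : ℂ)) * star U := by
    rw [← hd]
    calc T = (U * star U) * T * (U * star U) := by rw [hUU']; simp
      _ = _ := by simp only [Matrix.mul_assoc]
  have hev : ∀ i, hT.eigenvalues i = 0 ∨ hT.eigenvalues i = 1 := by
    intro i
    have h1 : diagonal (fun i => (hT.eigenvalues i : ℂ)) * diagonal (fun i => (hT.eigenvalues i : ℂ))
        = diagonal (fun i => (hT.eigenvalues i : ℂ)) := by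
      rw [← hd]
      calc star U * T * U * (star U * T * U) = star U * (T * ((U * star U) * T)) * U := by
            simp only [Matrix.mul_assoc]
        _ = _ := by rw [hUU', Matrix.one_mul, hi]
    rw [diagonal_mul_diagonal] at h1
    have h2 := congrFun (diagonal_injective h1) i
    have h3 : hT.eigenvalues i * hT.eigenvalues i = hT.eigenvalues i := by exact_mod_cast h2
    have h4 : hT.eigenvalues i * (hT.eigenvalues i - 1) = 0 := by linarith
    rcases mul_eq_zero.1 h4 with h | h
    · exact Or.inl h
    · exact Or.inr (by linarith)
  have hsum : ∑ i, hT.eigenvalues i = 1 := by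
    have := hT.trace_eq_sum_eigenvalues
    rw [htr] at this
    have h' : (((∑ i, hT.eigenvalues i : ℝ)) : ℂ) = 1 := by push_cast; exact this.symm
    exact_mod_cast h'
  obtain ⟨k, hk⟩ : ∃ k, hT.eigenvalues k = 1 := by
    by_contra hcon
    push Not at hcon
    have : ∑ i, hT.eigenvalues i = 0 :=
      Finset.sum_eq_zero fun i _ => (hev i).resolve_right (hcon i)
    linarith
  have hother : ∀ j, j ≠ k → hT.eigenvalues j = 0 := by
    intro j hj
    have h0 : ∑ i ∈ Finset.univ.erase k, hT.eigenvalues i = 0 := by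
      have := Finset.add_sum_erase Finset.univ hT.eigenvalues (Finset.mem_univ k)
      linarith
    rw [Finset.sum_eq_zero_iff_of_nonneg] at h0
    · exact h0 j (by simp [hj])
    · intro i _
      rcases hev i with h | h <;> rw [h]
      norm_num
  refine ⟨fun a => U a k, fun a b => ?_⟩
  conv_lhs => rw [hTe]
  rw [Matrix.mul_apply, Finset.sum_eq_single k]
  · rw [mul_diagonal, hk, star_apply]; simp
  · intro j _ hj
    rw [mul_diagonal, hother j hj]; simp
  · simp

theorem shannon_ge_vnEntropy_of_pure_decomposition {n m : ℕ}
    (σ : Matrix (Fin n) (Fin n) ℂ)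
    (hσ : σ.PosSemidef) (hσtr : σ.trace = 1)
    (p : Fin m → ℝ) (hp : ∀ i, 0 ≤ p i) (hpsum : ∑ i, p i = 1)
    (τ : Fin m → Matrix (Fin n) (Fin n) ℂ)
    (hherm : ∀ i, (τ i).IsHermitian)
    (hidem : ∀ i, τ i * τ i = τ i)
    (htr : ∀ i, (τ i).trace = 1)
    (hdecomp : σ = ∑ i, p i • τ i) :
    shannonEntropy p ≥ vnEntropy σ := by
  have hA := hσ.isHermitian
  set U : Matrix (Fin n) (Fin n) ℂ := (hA.eigenvectorUnitary : Matrix (Fin n) (Fin n) ℂ) with hU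
  have hUU' : U * star U = 1 := Unitary.coe_mul_star_self hA.eigenvectorUnitary
  have hd := aux_diag σ hA
  rw [← hU] at hd
  have hS : vnEntropy σ = ∑ j, Real.negMulLog (hA.eigenvalues j) := by
    have h1 : (σ * matFun Real.log σ).trace
        = ((∑ j, hA.eigenvalues j * Real.log (hA.eigenvalues j) : ℝ) : ℂ) := by
      have h2 : matFun Real.log σ
          = U * diagonal (fun i => (Real.log (hA.eigenvalues i) : ℂ)) * star U := by
        rw [matFun, dif_pos hA]
      rw [h2, ← Matrix.mul_assoc, trace_mul_comm, ← Matrix.mul_assoc, ← Matrix.mul_assoc, hd,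
        diagonal_mul_diagonal, trace_diagonal]
      push_cast
      rfl
    rw [vnEntropy, h1, Complex.ofReal_re, ← Finset.sum_neg_distrib]
    exact Finset.sum_congr rfl fun j _ => by rw [Real.negMulLog]; ring
  have hH : shannonEntropy p = ∑ i, Real.negMulLog (p i) := by
    rw [shannonEntropy, ← Finset.sum_neg_distrib]
    exact Finset.sum_congr rfl fun j _ => by rw [Real.negMulLog]; ring
  have hT : ∀ i, ∃ v : Fin n → ℂ, ∀ a b, (star U * τ i * U) a b = v a * star (v b) := by
    intro i
    apply aux_pure
    · have := isHermitian_conjTranspose_mul_mul U (hherm i)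
      exact this
    · calc star U * τ i * U * (star U * τ i * U) = star U * (τ i * ((U * star U) * τ i)) * U := by
            simp only [Matrix.mul_assoc]
        _ = _ := by rw [hUU', Matrix.one_mul, hidem]
    · rw [trace_mul_comm, ← Matrix.mul_assoc, hUU', Matrix.one_mul, htr]
  choose V hV using hT
  rw [hS, hH, ge_iff_le]
  refine aux_main V hA.eigenvalues p hσ.eigenvalues_nonneg hp ?_ ?_
  · intro j k
    have h1 : ∑ i, (p i : ℂ) • (star U * τ i * U) = diagonal (fun i => (hA.eigenvalues i : ℂ)) := by
      have h2 : star U * (∑ i, p i • τ i) * U = diagonal (fun i => (hA.eigenvalues i : ℂ)) := by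
        rw [← hdecomp]; exact hd
      rw [← h2, Finset.mul_sum, Finset.sum_mul]
      refine Finset.sum_congr rfl fun i _ => ?_
      rw [Matrix.mul_smul, Matrix.smul_mul, Complex.coe_smul]
    have h3 := congrFun (congrFun h1 j) k
    rw [Matrix.sum_apply, diagonal_apply] at h3
    rw [← h3]
    refine Finset.sum_congr rfl fun i _ => ?_
    rw [Matrix.smul_apply, hV, smul_eq_mul]
  · intro i
    have h1 : (star U * τ i * U).trace = 1 := by
      rw [trace_mul_comm, ← Matrix.mul_assoc, hUU', Matrix.one_mul, htr]
    rw [trace] at h1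
    simp only [diag_apply, hV, ← starRingEnd_apply, Complex.mul_conj] at h1
    exact_mod_cast h1
end

section
/- Let σ be a complex n×n density matrix, and let ρ₁,…,ρₘ be density matrices with ∑ⱼ ρⱼ = I (the identity matrix). Then the measurement outcome distribution (tr(ρ₁σ),…,tr(ρₘσ)) is a probability vector and its Shannon entropy dominates the von Neumann entropy of σ: H(tr(ρ₁σ),…,tr(ρₘσ)) ≥ S(σ). -/
open Matrix
open scoped ComplexOrder

/-- if `σ` is a density matrix and `ρ₁, …, ρₘ` are density matrices
with `∑ j, ρ j = 1` (the identity matrix), then the measurement outcome distribution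
`(tr (ρ j * σ))_j` is a probability vector and its Shannon entropy dominates the
von Neumann entropy of `σ`. -/
theorem fine_grained_measurement_entropy_ge {n m : ℕ}
    (σ : Matrix (Fin n) (Fin n) ℂ)
    (hσ : σ.PosSemidef) (hσtr : σ.trace = 1)
    (ρ : Fin m → Matrix (Fin n) (Fin n) ℂ)
    (hρ : ∀ j, (ρ j).PosSemidef) (hρtr : ∀ j, (ρ j).trace = 1)
    (hsum : ∑ j, ρ j = 1) :
    (∀ j, 0 ≤ ((ρ j * σ).trace).re) ∧
    (∑ j, ((ρ j * σ).trace).re = 1) ∧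
    shannonEntropy (fun j => ((ρ j * σ).trace).re) ≥ vnEntropy σ := by
  classical
  have hH : σ.IsHermitian := hσ.1
  set U : Matrix (Fin n) (Fin n) ℂ := (hH.eigenvectorUnitary : Matrix (Fin n) (Fin n) ℂ) with hU
  set l : Fin n → ℝ := hH.eigenvalues with hl
  have hUU : star U * U = 1 := Unitary.coe_star_mul_self hH.eigenvectorUnitary
  have hUU' : U * star U = 1 := Unitary.coe_mul_star_self hH.eigenvectorUnitary
  have hspec : σ = U * diagonal (fun i => (l i : ℂ)) * star U := by
    have h := hH.spectral_theorem
    rw [Unitary.conjStarAlgAut_apply] at h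
    exact h
  have hl0 : ∀ i, 0 ≤ l i := fun i => hσ.eigenvalues_nonneg i
  have hl1 : ∑ i, l i = 1 := by
    have h := hH.trace_eq_sum_eigenvalues
    rw [hσtr] at h
    have h2 := congrArg Complex.re h
    simpa using h2.symm
  have hpsd : ∀ j, (star U * ρ j * U).PosSemidef := fun j =>
    (hρ j).conjTranspose_mul_mul_same U
  have hW0 : ∀ j i, 0 ≤ ((star U * ρ j * U) i i).re := fun j i =>
    (Complex.le_def.1 ((hpsd j).diag_nonneg (i := i))).1
  have hWrow : ∀ j, ∑ i, ((star U * ρ j * U) i i).re = 1 := by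
    intro j
    have h : (star U * ρ j * U).trace = 1 := by
      rw [Matrix.trace_mul_cycle, hUU', Matrix.one_mul, hρtr]
    have h2 := congrArg Complex.re h
    simpa [Matrix.trace] using h2
  have hWcol : ∀ i, ∑ j, ((star U * ρ j * U) i i).re = 1 := by
    intro i
    have h : ∑ j, (star U * ρ j * U) = 1 := by
      rw [← Finset.sum_mul, ← Finset.mul_sum, hsum, Matrix.mul_one, hUU]
    have h2 := congrArg (fun M : Matrix (Fin n) (Fin n) ℂ => (M i i).re) h
    simpa [Matrix.sum_apply] using h2
  have hp : ∀ j, ((ρ j * σ).trace).re = ∑ i, ((star U * ρ j * U) i i).re * l i := by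
    intro j
    have h : (ρ j * σ).trace = (star U * ρ j * U * diagonal (fun i => (l i : ℂ))).trace := by
      conv_lhs => rw [hspec]
      rw [← Matrix.mul_assoc, Matrix.trace_mul_comm]
      simp only [Matrix.mul_assoc]
    rw [h]
    simp [Matrix.trace, Matrix.mul_diagonal]
  have hS : vnEntropy σ = ∑ i, Real.negMulLog (l i) := by
    have h : σ * matFun Real.log σ
        = U * diagonal (fun i => (l i : ℂ) * (Real.log (l i) : ℂ)) * star U := by
      have hm : matFun Real.log σ
          = U * diagonal (fun i => (Real.log (l i) : ℂ)) * star U := by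
        rw [matFun, dif_pos hH]
      rw [hm]
      conv_lhs => rw [hspec]
      calc U * diagonal (fun i => (l i : ℂ)) * star U *
            (U * diagonal (fun i => (Real.log (l i) : ℂ)) * star U)
          = U * diagonal (fun i => (l i : ℂ)) * (star U * U) *
            diagonal (fun i => (Real.log (l i) : ℂ)) * star U := by
              simp only [Matrix.mul_assoc]
        _ = _ := by rw [hUU, Matrix.mul_one, Matrix.mul_assoc U, Matrix.diagonal_mul_diagonal]
    rw [vnEntropy, h, Matrix.trace_mul_cycle, hUU, Matrix.one_mul, Matrix.trace_diagonal,
      Complex.re_sum, ← Finset.sum_neg_distrib]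
    refine Finset.sum_congr rfl fun i _ => ?_
    rw [← Complex.ofReal_mul, Complex.ofReal_re, Real.negMulLog_eq_neg]
  refine ⟨fun j => ?_, ?_, ?_⟩
  · rw [hp]
    exact Finset.sum_nonneg fun i _ => mul_nonneg (hW0 j i) (hl0 i)
  · simp_rw [hp]
    rw [Finset.sum_comm]
    simp_rw [← Finset.sum_mul, hWcol, one_mul, hl1]
  · have hSh : shannonEntropy (fun j => ((ρ j * σ).trace).re)
        = ∑ j, Real.negMulLog (∑ i, ((star U * ρ j * U) i i).re * l i) := by
      rw [shannonEntropy, ← Finset.sum_neg_distrib]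
      refine Finset.sum_congr rfl fun j _ => ?_
      rw [hp, Real.negMulLog_eq_neg]
    rw [hSh, hS, ge_iff_le]
    calc ∑ i, Real.negMulLog (l i)
        = ∑ j, ∑ i, ((star U * ρ j * U) i i).re * Real.negMulLog (l i) := by
          rw [Finset.sum_comm]
          simp_rw [← Finset.sum_mul, hWcol, one_mul]
      _ ≤ _ := Finset.sum_le_sum fun j _ =>
          Real.concaveOn_negMulLog.le_map_sum (fun i _ => hW0 j i) (hWrow j)
            (fun i _ => hl0 i)
end

section
/- For any complex n×n density matrix σ, the fine-grained entropy equals the von Neumann entropy: the infimum of H(tr(ρ₁σ),…,tr(ρₘσ)), taken over all finite families ρ₁,…,ρₘ of density matrices with ∑ⱼ ρⱼ = I, equals S(σ); the infimum is attained by taking the ρⱼ to be the rank-one projections onto an orthonormal eigenbasis of σ. -/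
open Matrix
open scoped ComplexOrder

lemma fg_spec {n : ℕ} {σ : Matrix (Fin n) (Fin n) ℂ} (h : σ.IsHermitian) :
    σ = (h.eigenvectorUnitary : Matrix (Fin n) (Fin n) ℂ) *
      Matrix.diagonal (fun i => (h.eigenvalues i : ℂ)) *
      (star (h.eigenvectorUnitary : Matrix (Fin n) (Fin n) ℂ)) := by
  have := h.spectral_theorem
  rw [Unitary.conjStarAlgAut_apply] at this
  exact this

lemma fg_trace {n : ℕ} (U R : Matrix (Fin n) (Fin n) ℂ) (d : Fin n → ℂ) :
    (R * (U * Matrix.diagonal d * star U)).trace = ∑ i, (star U * R * U) i i * d i := by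
  have : (R * (U * Matrix.diagonal d * star U)).trace
      = ((star U * R * U) * Matrix.diagonal d).trace := by
    rw [← Matrix.mul_assoc, Matrix.trace_mul_comm]
    simp only [Matrix.mul_assoc]
  rw [this]
  simp [Matrix.trace, Matrix.mul_diagonal]

lemma fg_vn {n : ℕ} {σ : Matrix (Fin n) (Fin n) ℂ} (h : σ.IsHermitian) :
    vnEntropy σ = ∑ i, Real.negMulLog (h.eigenvalues i) := by
  have hU : star (h.eigenvectorUnitary : Matrix (Fin n) (Fin n) ℂ) *
      (h.eigenvectorUnitary : Matrix (Fin n) (Fin n) ℂ) = 1 :=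
    Unitary.coe_star_mul_self _
  have hD : star (h.eigenvectorUnitary : Matrix (Fin n) (Fin n) ℂ) * σ *
      (h.eigenvectorUnitary : Matrix (Fin n) (Fin n) ℂ) =
      Matrix.diagonal (fun i => (h.eigenvalues i : ℂ)) := by
    conv_lhs => enter [1, 2]; rw [fg_spec h]
    simp only [← Matrix.mul_assoc, hU, Matrix.one_mul]
    rw [Matrix.mul_assoc, hU, Matrix.mul_one]
  unfold vnEntropy matFun
  rw [dif_pos h]
  rw [fg_trace, hD]
  simp only [Matrix.diagonal_apply_eq, ← Complex.ofReal_mul, ← Complex.ofReal_sum,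
    Complex.ofReal_re, Real.negMulLog, neg_mul, Finset.sum_neg_distrib]

/-- the fine-grained entropy equals the von Neumann entropy.
For a density matrix `σ`, the infimum of `H((tr (ρ j * σ))_j)` over all finite
families `ρ₁, …, ρₘ` of density matrices with `∑ j, ρ j = 1` (the identity) equals
`S(σ)`, and the infimum is attained (in particular by the rank-one projections onto
an orthonormal eigenbasis of `σ`). -/
theorem fine_grained_entropy_eq_vnEntropy {n : ℕ}
    (σ : Matrix (Fin n) (Fin n) ℂ)
    (hσ : σ.PosSemidef) (hσtr : σ.trace = 1) :
    IsLeast {x : ℝ | ∃ (m : ℕ) (ρ : Fin m → Matrix (Fin n) (Fin n) ℂ),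
        (∀ j, (ρ j).PosSemidef) ∧ (∀ j, (ρ j).trace = 1) ∧ (∑ j, ρ j = 1) ∧
        x = shannonEntropy (fun j => ((ρ j * σ).trace).re)}
      (vnEntropy σ) := by
  have h := hσ.isHermitian
  rw [fg_vn h]
  have hU : star (h.eigenvectorUnitary : Matrix (Fin n) (Fin n) ℂ) *
      (h.eigenvectorUnitary : Matrix (Fin n) (Fin n) ℂ) = 1 :=
    Unitary.coe_star_mul_self _
  have hU' : (h.eigenvectorUnitary : Matrix (Fin n) (Fin n) ℂ) *
      star (h.eigenvectorUnitary : Matrix (Fin n) (Fin n) ℂ) = 1 :=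
    Unitary.coe_mul_star_self _
  have hs := fg_spec h
  have hl : ∀ i, 0 ≤ h.eigenvalues i := hσ.eigenvalues_nonneg
  generalize (h.eigenvectorUnitary : Matrix (Fin n) (Fin n) ℂ) = U at hU hU' hs
  generalize h.eigenvalues = l at hs hl
  have htr : ∀ R : Matrix (Fin n) (Fin n) ℂ,
      ((R * σ).trace).re = ∑ i, ((star U * R * U) i i).re * l i := by
    intro R
    rw [hs, fg_trace, Complex.re_sum]
    simp
  constructor
  · refine ⟨n, fun j => U * Matrix.diagonal (Pi.single j 1) * star U, ?_, ?_, ?_, ?_⟩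
    · intro j
      apply Matrix.PosSemidef.mul_mul_conjTranspose_same
      apply Matrix.PosSemidef.diagonal
      intro i
      by_cases hij : i = j
      · subst hij; simp
      · simp [hij]
    · intro j
      rw [Matrix.trace_mul_comm, ← Matrix.mul_assoc, hU, Matrix.one_mul, Matrix.trace_diagonal]
      simp
    · rw [← Finset.sum_mul, ← Finset.mul_sum]
      have : ∑ j : Fin n, Matrix.diagonal (Pi.single j (1:ℂ)) = (1 : Matrix (Fin n) (Fin n) ℂ) := by
        ext a b
        simp only [Matrix.sum_apply, Matrix.diagonal_apply, Matrix.one_apply]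
        by_cases hab : a = b
        · simp [hab, Pi.single_apply]
        · simp [hab]
      rw [this, Matrix.mul_one, hU']
    · have key : ∀ j, star U * (U * Matrix.diagonal (Pi.single j (1:ℂ)) * star U) * U
          = Matrix.diagonal (Pi.single j (1:ℂ)) := by
        intro j
        simp only [← Matrix.mul_assoc, hU, Matrix.one_mul]
        rw [Matrix.mul_assoc, hU, Matrix.mul_one]
      have hp : ∀ j, (((U * Matrix.diagonal (Pi.single j (1:ℂ)) * star U) * σ).trace).re = l j := by
        intro j
        rw [htr, key, Finset.sum_eq_single j]
        · simp
        · intro b _ hb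
          simp [hb]
        · simp
      simp only [shannonEntropy, hp, Real.negMulLog, neg_mul, Finset.sum_neg_distrib]
  · rintro x ⟨m, ρ, hpos, ht, hsum, rfl⟩
    have hq : ∀ j i, 0 ≤ ((star U * ρ j * U) i i).re := by
      intro j i
      have := ((hpos j).conjTranspose_mul_mul_same U).diag_nonneg (i := i)
      exact (Complex.le_def.1 this).1
    have hrow : ∀ j, ∑ i, ((star U * ρ j * U) i i).re = 1 := by
      intro j
      have : (star U * ρ j * U).trace = 1 := by
        rw [Matrix.trace_mul_comm, ← Matrix.mul_assoc, hU', Matrix.one_mul, ht]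
      rw [← Complex.re_sum]
      exact (congrArg Complex.re this).trans Complex.one_re
    have hcol : ∀ i, ∑ j, ((star U * ρ j * U) i i).re = 1 := by
      intro i
      have : ∑ j, (star U * ρ j * U) = 1 := by
        rw [← Finset.sum_mul, ← Finset.mul_sum, hsum, Matrix.mul_one, hU]
      rw [← Complex.re_sum, ← Matrix.sum_apply, this]
      simp
    have hjen : ∀ j, ∑ i, ((star U * ρ j * U) i i).re * Real.negMulLog (l i) ≤
        Real.negMulLog (((ρ j * σ).trace).re) := by
      intro j
      rw [htr]
      have := Real.concaveOn_negMulLog.le_map_sum (t := Finset.univ)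
        (w := fun i => ((star U * ρ j * U) i i).re) (p := l)
        (fun i _ => hq j i) (hrow j) (fun i _ => hl i)
      simpa only [smul_eq_mul] using this
    calc ∑ i, Real.negMulLog (l i)
        = ∑ i, (∑ j, ((star U * ρ j * U) i i).re) * Real.negMulLog (l i) := by
          simp only [hcol, one_mul]
      _ = ∑ j, ∑ i, ((star U * ρ j * U) i i).re * Real.negMulLog (l i) := by
          simp only [Finset.sum_mul]
          exact Finset.sum_comm
      _ ≤ ∑ j, Real.negMulLog (((ρ j * σ).trace).re) :=
          Finset.sum_le_sum fun j _ => hjen j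
      _ = _ := by
          simp only [shannonEntropy, Real.negMulLog, neg_mul, Finset.sum_neg_distrib]
end

section
/- The von Neumann entropy is concave on density matrices: for all complex n×n density matrices ρ and σ and all t ∈ [0,1], S(t·ρ + (1−t)·σ) ≥ t·S(ρ) + (1−t)·S(σ). -/
open Matrix
open scoped ComplexOrder

theorem vn_spec {n : ℕ} {A : Matrix (Fin n) (Fin n) ℂ} (hA : A.IsHermitian) :
    A = (hA.eigenvectorUnitary : Matrix (Fin n) (Fin n) ℂ) *
      Matrix.diagonal (fun i => (hA.eigenvalues i : ℂ)) *
      (star hA.eigenvectorUnitary : Matrix (Fin n) (Fin n) ℂ) := by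
  have h := hA.spectral_theorem
  rw [Unitary.conjStarAlgAut_apply] at h
  exact h

theorem vn_eq_sum {n : ℕ} {A : Matrix (Fin n) (Fin n) ℂ} (hA : A.IsHermitian) :
    vnEntropy A = ∑ i, Real.negMulLog (hA.eigenvalues i) := by
  have hU : (star hA.eigenvectorUnitary : Matrix (Fin n) (Fin n) ℂ) *
      (hA.eigenvectorUnitary : Matrix (Fin n) (Fin n) ℂ) = 1 :=
    Unitary.coe_star_mul_self _
  have h : (A * matFun Real.log A).trace
      = ∑ i, ((hA.eigenvalues i * Real.log (hA.eigenvalues i) : ℝ) : ℂ) := by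
    unfold matFun
    rw [dif_pos hA]
    have hs := vn_spec hA
    set U := (hA.eigenvectorUnitary : Matrix (Fin n) (Fin n) ℂ)
    set D := Matrix.diagonal (fun i => (hA.eigenvalues i : ℂ)) with hD
    set L := Matrix.diagonal (fun i => (Real.log (hA.eigenvalues i) : ℂ)) with hL
    calc (A * (U * L * star U)).trace
        = ((U * D * star U) * (U * L * star U)).trace := by rw [← hs]
      _ = (U * (D * (star U * U) * L * star U)).trace := by simp only [Matrix.mul_assoc]
      _ = (D * L * (star U * U)).trace := by
        rw [hU, Matrix.trace_mul_comm]; simp only [Matrix.mul_assoc, Matrix.mul_one, hU]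
      _ = _ := by
        rw [hU, Matrix.mul_one, hD, hL, Matrix.diagonal_mul_diagonal, Matrix.trace_diagonal]
        simp
  unfold vnEntropy
  rw [h, ← Complex.ofReal_sum, Complex.ofReal_re, ← Finset.sum_neg_distrib]
  simp [Real.negMulLog]

theorem vn_row {n : ℕ} {W : Matrix (Fin n) (Fin n) ℂ} (hW : W * star W = 1) (i : Fin n) :
    ∑ j, Complex.normSq (W i j) = 1 := by
  have h := congrFun (congrFun hW i) i
  rw [Matrix.mul_apply, Matrix.one_apply_eq] at h
  simp only [Matrix.star_apply, Complex.star_def, Complex.mul_conj] at h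
  exact_mod_cast h

theorem vn_col {n : ℕ} {W : Matrix (Fin n) (Fin n) ℂ} (hW : star W * W = 1) (j : Fin n) :
    ∑ i, Complex.normSq (W i j) = 1 := by
  have h := congrFun (congrFun hW j) j
  rw [Matrix.mul_apply, Matrix.one_apply_eq] at h
  simp only [Matrix.star_apply, Complex.star_def, mul_comm _ (W _ _), Complex.mul_conj] at h
  exact_mod_cast h

theorem vn_peierls {n : ℕ} {A : Matrix (Fin n) (Fin n) ℂ} (hA : A.PosSemidef)
    {U : Matrix (Fin n) (Fin n) ℂ} (hU : star U * U = 1) :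
    vnEntropy A ≤ ∑ i, Real.negMulLog ((star U * A * U) i i).re := by
  have hU' : U * star U = 1 := mul_eq_one_comm.mp hU
  have hs := vn_spec hA.isHermitian
  have hV : (star hA.isHermitian.eigenvectorUnitary : Matrix (Fin n) (Fin n) ℂ) *
      (hA.isHermitian.eigenvectorUnitary : Matrix (Fin n) (Fin n) ℂ) = 1 :=
    Unitary.coe_star_mul_self _
  rw [vn_eq_sum hA.isHermitian]
  have hnn := hA.eigenvalues_nonneg
  set V := (hA.isHermitian.eigenvectorUnitary : Matrix (Fin n) (Fin n) ℂ)
  set l := hA.isHermitian.eigenvalues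
  have hV' : V * star V = 1 := mul_eq_one_comm.mp hV
  set W := star U * V with hWdef
  have hsW : star W = star V * U := by rw [hWdef, star_mul, star_star]
  have hW1 : W * star W = 1 := by
    rw [hsW, hWdef, Matrix.mul_assoc, ← Matrix.mul_assoc V, hV', Matrix.one_mul, hU]
  have hW2 : star W * W = 1 := mul_eq_one_comm.mp hW1
  have hd : ∀ i, ((star U * A * U) i i).re = ∑ j, Complex.normSq (W i j) • l j := by
    intro i
    have e : star U * A * U = W * Matrix.diagonal (fun i => (l i : ℂ)) * star W := by
      rw [hsW, hWdef]
      conv_lhs => rw [hs]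
      simp only [Matrix.mul_assoc]
    rw [e, Matrix.mul_apply, Complex.re_sum]
    refine Finset.sum_congr rfl fun j _ => ?_
    rw [Matrix.mul_diagonal, Matrix.star_apply, Complex.star_def, mul_right_comm,
      Complex.mul_conj, ← Complex.ofReal_mul, Complex.ofReal_re, smul_eq_mul]
  calc ∑ j, Real.negMulLog (l j)
      = ∑ j, ∑ i, Complex.normSq (W i j) • Real.negMulLog (l j) := by
        refine Finset.sum_congr rfl fun j _ => ?_
        rw [← Finset.sum_smul, vn_col hW2, one_smul]
    _ = ∑ i, ∑ j, Complex.normSq (W i j) • Real.negMulLog (l j) := Finset.sum_comm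
    _ ≤ _ := by
        refine Finset.sum_le_sum fun i _ => ?_
        rw [hd]
        exact Real.concaveOn_negMulLog.le_map_sum (fun j _ => Complex.normSq_nonneg _)
          (vn_row hW1 i) (fun j _ => hnn j)

theorem vn_diag_nonneg {n : ℕ} {A : Matrix (Fin n) (Fin n) ℂ} (hA : A.PosSemidef)
    (U : Matrix (Fin n) (Fin n) ℂ) (i : Fin n) : 0 ≤ ((star U * A * U) i i).re := by
  have h : (star U * A * U).PosSemidef := hA.conjTranspose_mul_mul_same U
  have h2 := h.diag_nonneg (i := i)
  exact (Complex.le_def.mp h2).1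

/-- the von Neumann entropy is concave on density matrices:
for density matrices `ρ`, `σ` and `t ∈ [0, 1]`,
`S(t • ρ + (1 - t) • σ) ≥ t * S(ρ) + (1 - t) * S(σ)`. -/
theorem vnEntropy_concave {n : ℕ}
    (ρ σ : Matrix (Fin n) (Fin n) ℂ)
    (hρ : ρ.PosSemidef) (hρtr : ρ.trace = 1)
    (hσ : σ.PosSemidef) (hσtr : σ.trace = 1)
    (t : ℝ) (ht0 : 0 ≤ t) (ht1 : t ≤ 1) :
    vnEntropy (t • ρ + (1 - t) • σ) ≥ t * vnEntropy ρ + (1 - t) * vnEntropy σ := by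
  have hτ : (t • ρ + (1 - t) • σ).IsHermitian :=
    ((hρ.smul ht0).add (hσ.smul (sub_nonneg.mpr ht1))).isHermitian
  have hU : (star hτ.eigenvectorUnitary : Matrix (Fin n) (Fin n) ℂ) *
      (hτ.eigenvectorUnitary : Matrix (Fin n) (Fin n) ℂ) = 1 :=
    Unitary.coe_star_mul_self _
  have hs := vn_spec hτ
  rw [vn_eq_sum hτ]
  set U := (hτ.eigenvectorUnitary : Matrix (Fin n) (Fin n) ℂ)
  have hd : ∀ i, hτ.eigenvalues i =
      t • ((star U * ρ * U) i i).re + (1 - t) • ((star U * σ * U) i i).re := by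
    intro i
    have e : star U * (t • ρ + (1 - t) • σ) * U =
        Matrix.diagonal (fun i => (hτ.eigenvalues i : ℂ)) := by
      calc star U * (t • ρ + (1 - t) • σ) * U
          = star U * (U * Matrix.diagonal (fun i => (hτ.eigenvalues i : ℂ)) * star U) * U := by
            rw [← hs]
        _ = (star U * U) * Matrix.diagonal (fun i => (hτ.eigenvalues i : ℂ)) * (star U * U) := by
            simp only [Matrix.mul_assoc]
        _ = _ := by rw [hU, Matrix.one_mul, Matrix.mul_one]
    have e2 := congrArg Complex.re (congrFun (congrFun e i) i)
    rw [Matrix.diagonal_apply_eq, Complex.ofReal_re] at e2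
    rw [← e2, Matrix.mul_add, Matrix.add_mul, Matrix.mul_smul, Matrix.mul_smul,
      Matrix.smul_mul, Matrix.smul_mul, Matrix.add_apply, Matrix.smul_apply, Matrix.smul_apply,
      Complex.add_re, Complex.smul_re, Complex.smul_re]
  have h1 := mul_le_mul_of_nonneg_left (vn_peierls hρ hU) ht0
  have h2 := mul_le_mul_of_nonneg_left (vn_peierls hσ hU) (sub_nonneg.mpr ht1)
  refine le_trans (add_le_add h1 h2) ?_
  rw [Finset.mul_sum, Finset.mul_sum, ← Finset.sum_add_distrib]
  refine Finset.sum_le_sum fun i _ => ?_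
  rw [hd i]
  exact Real.concaveOn_negMulLog.2 (vn_diag_nonneg hρ U i) (vn_diag_nonneg hσ U i) ht0
    (sub_nonneg.mpr ht1) (by ring)
end

section
/- Let σ be a density matrix on the bipartite space with index set A × B (a complex matrix indexed by pairs), let σ_A be its marginal on A given by the partial trace over B, i.e., σ_A(i, i') = ∑ⱼ σ((i,j), (i',j)), and let ρ_A (size |A|) and ρ_B (size |B|) be positive definite density matrices. Then the quantum relative entropy satisfies the marginal identity D(σ ‖ ρ_A ⊗ ρ_B) = D(σ ‖ σ_A ⊗ ρ_B) + D(σ_A ‖ ρ_A), where ⊗ denotes the Kronecker product. -/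
open Matrix Kronecker
open scoped ComplexOrder

/-- The marginal on the first factor (partial trace over the second factor). -/
noncomputable def margFst {A B : Type*} [Fintype A] [Fintype B]
    (σ : Matrix (A × B) (A × B) ℂ) : Matrix A A ℂ :=
  Matrix.of fun i i' => ∑ j, σ (i, j) (i', j)

lemma matFun_eq_of_unitary (f : ℝ → ℝ) {ι : Type*} [Fintype ι] [DecidableEq ι]
    (M U : Matrix ι ι ℂ) (hU : Uᴴ * U = 1) (d : ι → ℝ)
    (hM : M = U * Matrix.diagonal (fun i => (d i : ℂ)) * Uᴴ) :
    matFun f M = U * Matrix.diagonal (fun i => (f (d i) : ℂ)) * Uᴴ := by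
  have hU' : U * Uᴴ = 1 := mul_eq_one_comm.mp hU
  have hH : M.IsHermitian := by
    rw [Matrix.IsHermitian, hM]
    simp only [Matrix.conjTranspose_mul, Matrix.conjTranspose_conjTranspose,
      Matrix.diagonal_conjTranspose, Matrix.mul_assoc]
    congr 3
    ext i
    simp
  have hspec := hH.spectral_theorem
  unfold matFun
  rw [dif_pos hH]
  obtain ⟨V, hV⟩ : ∃ V : Matrix ι ι ℂ, V = (hH.eigenvectorUnitary : Matrix ι ι ℂ) := ⟨_, rfl⟩
  have hVV : Vᴴ * V = 1 := by
    rw [hV]; exact Unitary.coe_star_mul_self hH.eigenvectorUnitary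
  have hVV' : V * Vᴴ = 1 := mul_eq_one_comm.mp hVV
  have hsp : M = V * Matrix.diagonal (fun i => (hH.eigenvalues i : ℂ)) * Vᴴ := by
    rw [hV]
    conv_lhs => rw [hspec]
    rfl
  change (hH.eigenvectorUnitary : Matrix ι ι ℂ) * _ * (hH.eigenvectorUnitary : Matrix ι ι ℂ)ᴴ = _
  rw [← hV]
  generalize hH.eigenvalues = e at hsp
  have key : (Uᴴ * V) * Matrix.diagonal (fun i => (e i : ℂ)) =
      Matrix.diagonal (fun i => (d i : ℂ)) * (Uᴴ * V) := by
    have h := hsp.symm.trans hM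
    calc _ = Uᴴ * (V * Matrix.diagonal (fun i => (e i : ℂ)) * Vᴴ) * V := by
          simp only [Matrix.mul_assoc, hVV, Matrix.mul_one]
      _ = (Uᴴ * U) * Matrix.diagonal (fun i => (d i : ℂ)) * (Uᴴ * V) := by
          rw [h]; simp only [Matrix.mul_assoc]
      _ = _ := by rw [hU, Matrix.one_mul]
  have key2 : (Uᴴ * V) * Matrix.diagonal (fun i => (f (e i) : ℂ)) =
      Matrix.diagonal (fun i => (f (d i) : ℂ)) * (Uᴴ * V) := by
    ext i j
    have h := congrFun (congrFun key i) j
    rw [Matrix.mul_diagonal, Matrix.diagonal_mul] at h ⊢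
    by_cases h0 : (Uᴴ * V) i j = 0
    · simp [h0]
    · rw [mul_comm] at h
      have h1 := mul_right_cancel₀ h0 h
      have h2 : e j = d i := by exact_mod_cast h1
      rw [h2, mul_comm]
  calc V * Matrix.diagonal (fun i => (f (e i) : ℂ)) * Vᴴ
      = U * ((Uᴴ * V) * Matrix.diagonal (fun i => (f (e i) : ℂ))) * Vᴴ := by
        rw [← Matrix.mul_assoc, ← Matrix.mul_assoc, hU', Matrix.one_mul]
    _ = U * Matrix.diagonal (fun i => (f (d i) : ℂ)) * Uᴴ * (V * Vᴴ) := by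
        rw [key2]; simp only [Matrix.mul_assoc]
    _ = _ := by rw [hVV', Matrix.mul_one]

lemma exists_spectral {ι : Type*} [Fintype ι] [DecidableEq ι]
    (M : Matrix ι ι ℂ) (hH : M.IsHermitian) :
    ∃ U : Matrix ι ι ℂ, Uᴴ * U = 1 ∧
      M = U * Matrix.diagonal (fun i => (hH.eigenvalues i : ℂ)) * Uᴴ := by
  refine ⟨hH.eigenvectorUnitary, Unitary.coe_star_mul_self hH.eigenvectorUnitary, ?_⟩
  conv_lhs => rw [hH.spectral_theorem]
  rfl

/-- indicator of nonzero reals -/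
noncomputable def nzInd (x : ℝ) : ℝ := if x = 0 then 0 else 1

lemma matLog_kronecker {A B : Type*}
    [Fintype A] [DecidableEq A] [Fintype B] [DecidableEq B]
    (X : Matrix A A ℂ) (hX : X.IsHermitian) (Y : Matrix B B ℂ) (hY : Y.PosDef) :
    matLog (X ⊗ₖ Y) = matLog X ⊗ₖ (1 : Matrix B B ℂ) + matFun nzInd X ⊗ₖ matLog Y := by
  obtain ⟨U, hU, hUX⟩ := exists_spectral X hX
  obtain ⟨V, hV, hVY⟩ := exists_spectral Y hY.1
  have hpos := hY.eigenvalues_pos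
  generalize hX.eigenvalues = a at hUX
  generalize hY.1.eigenvalues = b at hVY hpos
  have hV' : V * Vᴴ = 1 := mul_eq_one_comm.mp hV
  unfold matLog
  rw [matFun_eq_of_unitary _ X U hU a hUX, matFun_eq_of_unitary _ X U hU a hUX,
    matFun_eq_of_unitary _ Y V hV b hVY,
    matFun_eq_of_unitary Real.log (X ⊗ₖ Y) (U ⊗ₖ V) ?_ (fun p => a p.1 * b p.2) ?_]
  · have h1 : (1 : Matrix B B ℂ) = V * 1 * Vᴴ := by rw [Matrix.mul_one, hV']
    rw [h1, Matrix.conjTranspose_kronecker]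
    simp only [Matrix.mul_kronecker_mul]
    rw [← Matrix.add_mul, ← Matrix.mul_add, ← Matrix.diagonal_one,
      Matrix.diagonal_kronecker_diagonal, Matrix.diagonal_kronecker_diagonal,
      Matrix.diagonal_add]
    congr 3
    ext p
    by_cases h : a p.1 = 0
    · simp [h, nzInd]
    · rw [Real.log_mul h (hpos _).ne']
      simp [h, nzInd]
  · rw [Matrix.conjTranspose_kronecker, ← Matrix.mul_kronecker_mul, hU, hV,
      Matrix.one_kronecker_one]
  · rw [hUX, hVY, Matrix.conjTranspose_kronecker]
    simp only [Matrix.mul_kronecker_mul]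
    rw [Matrix.diagonal_kronecker_diagonal]
    simp

lemma trace_mul_kron_one {A B : Type*}
    [Fintype A] [DecidableEq A] [Fintype B] [DecidableEq B]
    (σ : Matrix (A × B) (A × B) ℂ) (X : Matrix A A ℂ) :
    (σ * (X ⊗ₖ (1 : Matrix B B ℂ))).trace = (margFst σ * X).trace := by
  simp only [Matrix.trace, Matrix.diag, Matrix.mul_apply, Fintype.sum_prod_type,
    Matrix.kroneckerMap_apply, Matrix.one_apply, margFst, Matrix.of_apply, mul_ite, mul_one,
    mul_zero, Finset.sum_ite_eq', Finset.mem_univ, if_true, Finset.sum_mul]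
  refine Finset.sum_congr rfl fun i _ => ?_
  rw [Finset.sum_comm]

lemma margFst_isHermitian {A B : Type*} [Fintype A] [Fintype B]
    (σ : Matrix (A × B) (A × B) ℂ) (h : σ.IsHermitian) : (margFst σ).IsHermitian := by
  ext i j
  simp only [margFst, Matrix.conjTranspose_apply, Matrix.of_apply, star_sum]
  exact Finset.sum_congr rfl fun k _ => h.apply _ _

lemma support_lemma {A B : Type*}
    [Fintype A] [DecidableEq A] [Fintype B] [DecidableEq B]
    (σ : Matrix (A × B) (A × B) ℂ) (hσ : σ.PosSemidef) :
    σ * (matFun nzInd (margFst σ) ⊗ₖ (1 : Matrix B B ℂ)) = σ := by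
  have hX := margFst_isHermitian σ hσ.1
  obtain ⟨U, hU, hUX⟩ := exists_spectral _ hX
  generalize hX.eigenvalues = a at hUX
  have hU' : U * Uᴴ = 1 := mul_eq_one_comm.mp hU
  rw [matFun_eq_of_unitary _ _ U hU a hUX]
  set P : Matrix A A ℂ := U * Matrix.diagonal (fun i => (nzInd (a i) : ℂ)) * Uᴴ with hP
  have hmul : ∀ D E : Matrix A A ℂ, (U * D * Uᴴ) * (U * E * Uᴴ) = U * (D * E) * Uᴴ := by
    intro D E
    calc _ = U * D * (Uᴴ * U) * E * Uᴴ := by simp only [Matrix.mul_assoc]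
      _ = _ := by rw [hU]; simp only [Matrix.mul_assoc, Matrix.mul_one]
  have hPP : P * P = P := by
    rw [hP, hmul, Matrix.diagonal_mul_diagonal]
    congr 3
    ext i
    by_cases h : a i = 0 <;> simp [nzInd, h]
  have hPH : Pᴴ = P := by
    rw [hP]
    simp only [Matrix.conjTranspose_mul, Matrix.conjTranspose_conjTranspose,
      Matrix.diagonal_conjTranspose, Matrix.mul_assoc]
    congr 3
    ext i
    simp
  have hXP : margFst σ * P = margFst σ := by
    rw [hP]
    conv_lhs => rw [hUX]
    conv_rhs => rw [hUX]
    rw [hmul, Matrix.diagonal_mul_diagonal]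
    congr 3
    ext i
    by_cases h : a i = 0 <;> simp [nzInd, h]
  set Q : Matrix (A × B) (A × B) ℂ := (1 - P) ⊗ₖ (1 : Matrix B B ℂ) with hQ
  have hQQ : Q * Q = Q := by
    rw [hQ, ← Matrix.mul_kronecker_mul, Matrix.mul_one]
    congr 1
    rw [Matrix.mul_sub, Matrix.sub_mul, Matrix.sub_mul, hPP]
    simp
  have hQH : Qᴴ = Q := by
    rw [hQ, Matrix.conjTranspose_kronecker]; simp [hPH]
  have htr : (σ * Q).trace = 0 := by
    rw [hQ, trace_mul_kron_one, Matrix.mul_sub, hXP]; simp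
  obtain ⟨C, hC⟩ : ∃ C : Matrix (A × B) (A × B) ℂ, σ = Cᴴ * C := by
    open scoped MatrixOrder in
    exact CStarAlgebra.nonneg_iff_eq_star_mul_self.mp hσ.nonneg
  have hCQ : C * Q = 0 := by
    rw [← Matrix.trace_conjTranspose_mul_self_eq_zero_iff, Matrix.conjTranspose_mul, hQH,
      Matrix.mul_assoc, Matrix.trace_mul_comm, ← Matrix.mul_assoc, ← hC, Matrix.mul_assoc, hQQ, htr]
  have hσQ : σ * Q = 0 := by rw [hC, Matrix.mul_assoc, hCQ, Matrix.mul_zero]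
  have hQ' : P ⊗ₖ (1 : Matrix B B ℂ) = 1 - Q := by
    rw [hQ, ← Matrix.one_kronecker_one, eq_sub_iff_add_eq, ← Matrix.add_kronecker]
    simp
  rw [hQ', Matrix.mul_sub, hσQ]; simp

lemma matFun_nzInd_posDef {A : Type*} [Fintype A] [DecidableEq A]
    (X : Matrix A A ℂ) (hX : X.PosDef) : matFun nzInd X = 1 := by
  obtain ⟨U, hU, hUX⟩ := exists_spectral X hX.1
  rw [matFun_eq_of_unitary _ X U hU _ hUX]
  have : (fun i => ((nzInd (hX.1.eigenvalues i) : ℝ) : ℂ)) = fun _ => 1 := by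
    ext i; simp [nzInd, (hX.eigenvalues_pos i).ne']
  rw [this, Matrix.diagonal_one, Matrix.mul_one, mul_eq_one_comm.mp hU]

/-- the marginal identity for quantum relative entropy. If `σ` is a
density matrix on a bipartite space `A × B` with marginal `σ_A` on `A`, and `ρ_A`,
`ρ_B` are positive definite density matrices, then
`D(σ ‖ ρ_A ⊗ ρ_B) = D(σ ‖ σ_A ⊗ ρ_B) + D(σ_A ‖ ρ_A)`. -/
theorem qRelEnt_marginal_identity {A B : Type*}
    [Fintype A] [DecidableEq A] [Fintype B] [DecidableEq B]
    (σ : Matrix (A × B) (A × B) ℂ)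
    (hσ : σ.PosSemidef) (hσtr : σ.trace = 1)
    (ρA : Matrix A A ℂ) (hρA : ρA.PosDef) (hρAtr : ρA.trace = 1)
    (ρB : Matrix B B ℂ) (hρB : ρB.PosDef) (hρBtr : ρB.trace = 1) :
    qRelEnt σ (ρA ⊗ₖ ρB) = qRelEnt σ (margFst σ ⊗ₖ ρB) + qRelEnt (margFst σ) ρA := by
  have h1 := matLog_kronecker ρA hρA.1 ρB hρB
  have h2 := matLog_kronecker (margFst σ) (margFst_isHermitian σ hσ.1) ρB hρB
  have h3 : σ * (matFun nzInd (margFst σ) ⊗ₖ matLog ρB)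
      = σ * ((1 : Matrix A A ℂ) ⊗ₖ matLog ρB) := by
    conv_rhs => rw [← support_lemma σ hσ]
    rw [Matrix.mul_assoc, ← Matrix.mul_kronecker_mul, Matrix.mul_one, Matrix.one_mul]
  rw [matFun_nzInd_posDef ρA hρA] at h1
  unfold qRelEnt
  rw [h1, h2, ← Complex.add_re]
  congr 1
  simp only [Matrix.mul_sub, Matrix.mul_add, Matrix.trace_sub, Matrix.trace_add, h3,
    trace_mul_kron_one]
  ring
end

section
/- Let σ be a positive definite density matrix on the tripartite space indexed by A × B × C, with marginals σ_AC, σ_BC, σ_A, σ_B, σ_C given by partial traces. Then the conditional mutual information is nonnegative: I_σ(A;B|C) = D(σ ‖ σ_A ⊗ σ_B ⊗ σ_C) − D(σ_AC ‖ σ_A ⊗ σ_C) − D(σ_BC ‖ σ_B ⊗ σ_C) ≥ 0. -/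
open Matrix Kronecker
open scoped ComplexOrder

section Marginals

variable {A B C : Type*} [Fintype A] [Fintype B] [Fintype C]

/-- Marginal on `A` of a tripartite matrix (partial trace over `B` and `C`). -/
noncomputable def margA (σ : Matrix (A × B × C) (A × B × C) ℂ) : Matrix A A ℂ :=
  Matrix.of fun i i' => ∑ j : B, ∑ k : C, σ (i, j, k) (i', j, k)

/-- Marginal on `B` of a tripartite matrix (partial trace over `A` and `C`). -/
noncomputable def margB (σ : Matrix (A × B × C) (A × B × C) ℂ) : Matrix B B ℂ :=
  Matrix.of fun j j' => ∑ i : A, ∑ k : C, σ (i, j, k) (i, j', k)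

/-- Marginal on `C` of a tripartite matrix (partial trace over `A` and `B`). -/
noncomputable def margC (σ : Matrix (A × B × C) (A × B × C) ℂ) : Matrix C C ℂ :=
  Matrix.of fun k k' => ∑ i : A, ∑ j : B, σ (i, j, k) (i, j, k')

/-- Marginal on `A × C` of a tripartite matrix (partial trace over `B`). -/
noncomputable def margAC (σ : Matrix (A × B × C) (A × B × C) ℂ) : Matrix (A × C) (A × C) ℂ :=
  Matrix.of fun x y => ∑ j : B, σ (x.1, j, x.2) (y.1, j, y.2)

/-- Marginal on `B × C` of a tripartite matrix (partial trace over `A`). -/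
noncomputable def margBC (σ : Matrix (A × B × C) (A × B × C) ℂ) : Matrix (B × C) (B × C) ℂ :=
  Matrix.of fun x y => ∑ i : A, σ (i, x.1, x.2) (i, y.1, y.2)

end Marginals

section Helpers

/-- `matFun` is computed by any unitary diagonalization. -/
theorem matFun_eq_of_diag (f : ℝ → ℝ) {ι : Type*} [Fintype ι] [DecidableEq ι]
    (M V : Matrix ι ι ℂ) (d : ι → ℝ) (h1 : V * Vᴴ = 1) (h2 : Vᴴ * V = 1)
    (hM : M = V * Matrix.diagonal (fun i => (d i : ℂ)) * Vᴴ) :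
    matFun f M = V * Matrix.diagonal (fun i => (f (d i) : ℂ)) * Vᴴ := by
  have hH : M.IsHermitian := by
    rw [hM]
    apply Matrix.isHermitian_mul_mul_conjTranspose
    rw [Matrix.IsHermitian, Matrix.diagonal_conjTranspose]
    congr 1
    ext i
    simp
  unfold matFun
  rw [dif_pos hH]
  set U : Matrix ι ι ℂ := (hH.eigenvectorUnitary : Matrix ι ι ℂ) with hU
  have hs : (star hH.eigenvectorUnitary : Matrix ι ι ℂ) = Uᴴ := rfl
  have u1 : U * Uᴴ = 1 := by
    have := Unitary.mul_star_self_of_mem (hH.eigenvectorUnitary).2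
    simpa [Matrix.star_eq_conjTranspose] using this
  have u2 : Uᴴ * U = 1 := by
    have := Unitary.star_mul_self_of_mem (hH.eigenvectorUnitary).2
    simpa [Matrix.star_eq_conjTranspose] using this
  have hsp : M = U * Matrix.diagonal (fun i => (hH.eigenvalues i : ℂ)) * Uᴴ := by
    have := hH.spectral_theorem
    simpa [Unitary.conjStarAlgAut_apply, Function.comp_def, Matrix.star_eq_conjTranspose] using this
  rw [hs]
  -- intertwiner
  have hw : Matrix.diagonal (fun i => (hH.eigenvalues i : ℂ)) * (Uᴴ * V)
      = (Uᴴ * V) * Matrix.diagonal (fun i => (d i : ℂ)) := by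
    have e1 : Uᴴ * M * V = Matrix.diagonal (fun i => (hH.eigenvalues i : ℂ)) * (Uᴴ * V) := by
      conv_lhs => rw [hsp]
      calc _ = (Uᴴ * U) * Matrix.diagonal (fun i => (hH.eigenvalues i : ℂ)) * (Uᴴ * V) := by
            simp only [Matrix.mul_assoc]
        _ = _ := by rw [u2, Matrix.one_mul]
    have e2 : Uᴴ * M * V = (Uᴴ * V) * Matrix.diagonal (fun i => (d i : ℂ)) := by
      conv_lhs => rw [hM]
      calc _ = (Uᴴ * V) * Matrix.diagonal (fun i => (d i : ℂ)) * (Vᴴ * V) := by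
            simp only [Matrix.mul_assoc]
        _ = _ := by rw [h2, Matrix.mul_one]
    rw [← e1, e2]
  have hw' : Matrix.diagonal (fun i => (f (hH.eigenvalues i) : ℂ)) * (Uᴴ * V)
      = (Uᴴ * V) * Matrix.diagonal (fun i => (f (d i) : ℂ)) := by
    ext i j
    have := congrFun (congrFun hw i) j
    rw [Matrix.diagonal_mul, Matrix.mul_diagonal] at this ⊢
    by_cases h0 : (Uᴴ * V) i j = 0
    · rw [h0]; simp
    · have h3 : (hH.eigenvalues i : ℂ) = d j := by
        apply mul_right_cancel₀ h0
        rw [this, mul_comm]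
      have h4 : hH.eigenvalues i = d j := by exact_mod_cast h3
      rw [h4, mul_comm]
  calc _ = U * (Matrix.diagonal (fun i => (f (hH.eigenvalues i) : ℂ)) * (Uᴴ * V)) * Vᴴ := by
        rw [← Matrix.mul_one (U * Matrix.diagonal _ * Uᴴ), ← h1]
        simp only [Matrix.mul_assoc]
    _ = (U * Uᴴ) * (V * Matrix.diagonal (fun i => (f (d i) : ℂ)) * Vᴴ) := by
        rw [hw']; simp only [Matrix.mul_assoc]
    _ = _ := by rw [u1, Matrix.one_mul]

theorem posDef_spectral {ι : Type*} [Fintype ι] [DecidableEq ι]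
    (M : Matrix ι ι ℂ) (hM : M.PosDef) :
    ∃ (U : Matrix ι ι ℂ) (d : ι → ℝ), (∀ i, 0 < d i) ∧ U * Uᴴ = 1 ∧ Uᴴ * U = 1 ∧
      M = U * Matrix.diagonal (fun i => (d i : ℂ)) * Uᴴ ∧
      matLog M = U * Matrix.diagonal (fun i => (Real.log (d i) : ℂ)) * Uᴴ := by
  have hH := hM.isHermitian
  refine ⟨hH.eigenvectorUnitary, hH.eigenvalues, fun i => hM.eigenvalues_pos i, ?_, ?_, ?_, ?_⟩
  · have := Unitary.mul_star_self_of_mem (hH.eigenvectorUnitary).2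
    simpa [Matrix.star_eq_conjTranspose] using this
  · have := Unitary.star_mul_self_of_mem (hH.eigenvectorUnitary).2
    simpa [Matrix.star_eq_conjTranspose] using this
  · have := hH.spectral_theorem
    simpa [Unitary.conjStarAlgAut_apply, Function.comp_def, Matrix.star_eq_conjTranspose] using this
  · unfold matLog matFun
    rw [dif_pos hH]
    rfl

theorem matLog_kronecker_s14 {ι κ : Type*} [Fintype ι] [DecidableEq ι] [Fintype κ] [DecidableEq κ]
    (M : Matrix ι ι ℂ) (N : Matrix κ κ ℂ) (hM : M.PosDef) (hN : N.PosDef) :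
    matLog (M ⊗ₖ N) = matLog M ⊗ₖ (1 : Matrix κ κ ℂ) + (1 : Matrix ι ι ℂ) ⊗ₖ matLog N := by
  obtain ⟨U, d, hd, u1, u2, hU, lU⟩ := posDef_spectral M hM
  obtain ⟨V, e, he, v1, v2, hV, lV⟩ := posDef_spectral N hN
  have key := matFun_eq_of_diag Real.log (M ⊗ₖ N) (U ⊗ₖ V) (fun x => d x.1 * e x.2)
    (by rw [Matrix.conjTranspose_kronecker, ← Matrix.mul_kronecker_mul, u1, v1,
          Matrix.one_kronecker_one])
    (by rw [Matrix.conjTranspose_kronecker, ← Matrix.mul_kronecker_mul, u2, v2,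
          Matrix.one_kronecker_one])
    (by
      have : Matrix.diagonal (fun x : ι × κ => ((d x.1 * e x.2 : ℝ) : ℂ))
          = Matrix.diagonal (fun i => (d i : ℂ)) ⊗ₖ Matrix.diagonal (fun i => (e i : ℂ)) := by
        rw [Matrix.diagonal_kronecker_diagonal]; simp
      rw [this, Matrix.conjTranspose_kronecker, ← Matrix.mul_kronecker_mul,
        ← Matrix.mul_kronecker_mul, ← hU, ← hV])
  have hdiag : Matrix.diagonal (fun x : ι × κ => ((Real.log (d x.1 * e x.2) : ℝ) : ℂ))
      = Matrix.diagonal (fun i => (Real.log (d i) : ℂ)) ⊗ₖ (1 : Matrix κ κ ℂ)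
        + (1 : Matrix ι ι ℂ) ⊗ₖ Matrix.diagonal (fun i => (Real.log (e i) : ℂ)) := by
    rw [← Matrix.diagonal_one, ← Matrix.diagonal_one, Matrix.diagonal_kronecker_diagonal,
      Matrix.diagonal_kronecker_diagonal, Matrix.diagonal_add]
    congr 1
    ext x
    rw [Real.log_mul (hd _).ne' (he _).ne']
    simp
  unfold matLog at lU lV ⊢
  rw [key, hdiag, lU, lV, Matrix.mul_add, Matrix.add_mul, Matrix.conjTranspose_kronecker,
    ← Matrix.mul_kronecker_mul, ← Matrix.mul_kronecker_mul,
    ← Matrix.mul_kronecker_mul, ← Matrix.mul_kronecker_mul,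
    Matrix.mul_one, Matrix.mul_one, u1, v1]

/-- The quadratic form whose supremum is the resolvent expectation. -/
noncomputable def quadG {ι : Type*} [Fintype ι] (t : ℝ) (ρ τ X : Matrix ι ι ℂ) : ℝ :=
  2 * (Xᴴ * ρ).trace.re - (X * Xᴴ * τ).trace.re - t * (Xᴴ * X * ρ).trace.re

theorem scalar_le (q p t : ℝ) (hq : 0 < q) (hp : 0 < p) (ht : 0 ≤ t) (y w : ℂ) :
    2 * (star y * w * p).re - q * Complex.normSq y - t * (p * Complex.normSq y)
      ≤ Complex.normSq w * (p ^ 2 / (q + t * p)) := by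
  have hs : 0 < q + t * p := by positivity
  rw [← mul_div_assoc, le_div_iff₀ hs]
  simp only [Complex.normSq_apply, Complex.mul_re, Complex.mul_im, Complex.star_def,
    Complex.conj_re, Complex.conj_im, Complex.ofReal_re, Complex.ofReal_im]
  nlinarith [sq_nonneg ((q + t * p) * y.re - w.re * p), sq_nonneg ((q + t * p) * y.im - w.im * p)]

theorem scalar_eq (q p t : ℝ) (hq : 0 < q) (hp : 0 < p) (ht : 0 ≤ t) (w : ℂ) :
    2 * (star (w * ((p / (q + t * p) : ℝ) : ℂ)) * w * p).re
      - q * Complex.normSq (w * ((p / (q + t * p) : ℝ) : ℂ))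
      - t * (p * Complex.normSq (w * ((p / (q + t * p) : ℝ) : ℂ)))
      = Complex.normSq w * (p ^ 2 / (q + t * p)) := by
  have hs : q + t * p ≠ 0 := by positivity
  simp only [Complex.normSq_apply, Complex.mul_re, Complex.mul_im, Complex.star_def,
    Complex.conj_re, Complex.conj_im, Complex.ofReal_re, Complex.ofReal_im]
  field_simp
  ring

/-- Representation of the relative entropy. -/
theorem relEnt_repr {ι : Type*} [Fintype ι] [DecidableEq ι]
    (ρ τ : Matrix ι ι ℂ) (hρ : ρ.PosDef) (hτ : τ.PosDef) :
    ∃ F H : ℝ → ℝ, (∀ t, 0 ≤ t → ∀ X, quadG t ρ τ X ≤ F t) ∧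
      (∀ t, 0 ≤ t → ∃ X, quadG t ρ τ X = F t) ∧
      H 0 = 0 ∧
      (∀ t, 0 ≤ t → HasDerivAt H (F t - ρ.trace.re / (1 + t)) t) ∧
      Filter.Tendsto H Filter.atTop (nhds (qRelEnt ρ τ)) := by
  obtain ⟨U, p, hp, u1, u2, hU, lU⟩ := posDef_spectral ρ hρ
  obtain ⟨V, q, hq, v1, v2, hV, lV⟩ := posDef_spectral τ hτ
  set W : Matrix ι ι ℂ := Vᴴ * U with hW
  have hWW : Wᴴ * W = 1 := by
    rw [hW, Matrix.conjTranspose_mul, Matrix.conjTranspose_conjTranspose]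
    calc _ = Uᴴ * (V * Vᴴ) * U := by simp only [Matrix.mul_assoc]
      _ = 1 := by rw [v1, Matrix.mul_one, u2]
  have hsum : ∀ i, ∑ j, Complex.normSq (W j i) = 1 := by
    intro i
    have := congrFun (congrFun hWW i) i
    rw [Matrix.mul_apply, Matrix.one_apply_eq] at this
    have h2 := congrArg Complex.re this
    simpa [Matrix.conjTranspose_apply, Complex.normSq_apply] using h2
  have htr : ρ.trace.re = ∑ i, ∑ j, Complex.normSq (W j i) * p i := by
    simp_rw [← Finset.sum_mul, hsum, one_mul]
    rw [hU, Matrix.trace_mul_comm, ← Matrix.mul_assoc, u2, Matrix.one_mul, Matrix.trace_diagonal]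
    simp
  -- quadratic form in coordinates
  have hG : ∀ t Y, quadG t ρ τ (V * Y * Uᴴ) = ∑ i, ∑ j,
      (2 * (star (Y j i) * W j i * p i).re - q j * Complex.normSq (Y j i)
        - t * (p i * Complex.normSq (Y j i))) := by
    intro t Y
    have e0 : (V * Y * Uᴴ)ᴴ = U * Yᴴ * Vᴴ := by
      simp [Matrix.conjTranspose_mul, Matrix.mul_assoc]
    have e1 : ((V * Y * Uᴴ)ᴴ * ρ).trace
        = (Yᴴ * (W * Matrix.diagonal (fun i => (p i : ℂ)))).trace := by
      rw [e0]
      conv_lhs => rw [hU]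
      calc _ = (U * (Yᴴ * ((Vᴴ * U) * Matrix.diagonal (fun i => (p i : ℂ)) * Uᴴ))).trace := by
            simp only [Matrix.mul_assoc]
        _ = ((Yᴴ * (W * Matrix.diagonal (fun i => (p i : ℂ)))) * (Uᴴ * U)).trace := by
            rw [Matrix.trace_mul_comm]; simp only [Matrix.mul_assoc, hW]
        _ = _ := by rw [u2, Matrix.mul_one]
    have e2 : ((V * Y * Uᴴ) * (V * Y * Uᴴ)ᴴ * τ).trace
        = (Yᴴ * (Matrix.diagonal (fun i => (q i : ℂ)) * Y)).trace := by
      rw [e0]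
      conv_lhs => rw [hV]
      calc _ = (V * (Y * (Uᴴ * U) * Yᴴ * (Vᴴ * V)
              * Matrix.diagonal (fun i => (q i : ℂ)) * Vᴴ)).trace := by
            simp only [Matrix.mul_assoc]
        _ = ((Y * (Yᴴ * Matrix.diagonal (fun i => (q i : ℂ)))) * (Vᴴ * V)).trace := by
            rw [Matrix.trace_mul_comm, u2, v2]; simp only [Matrix.mul_assoc, Matrix.mul_one]
            rw [v2, Matrix.mul_one]
        _ = _ := by rw [v2, Matrix.mul_one, Matrix.trace_mul_comm, Matrix.mul_assoc]
    have e3 : ((V * Y * Uᴴ)ᴴ * (V * Y * Uᴴ) * ρ).trace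
        = (Yᴴ * (Y * Matrix.diagonal (fun i => (p i : ℂ)))).trace := by
      rw [e0]
      conv_lhs => rw [hU]
      calc _ = (U * (Yᴴ * (Vᴴ * V) * Y * (Uᴴ * U)
              * Matrix.diagonal (fun i => (p i : ℂ)) * Uᴴ)).trace := by
            simp only [Matrix.mul_assoc]
        _ = ((Yᴴ * (Y * Matrix.diagonal (fun i => (p i : ℂ)))) * (Uᴴ * U)).trace := by
            rw [Matrix.trace_mul_comm, u2, v2]; simp only [Matrix.mul_assoc, Matrix.mul_one]
            rw [u2, Matrix.mul_one]
        _ = _ := by rw [u2, Matrix.mul_one]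
    unfold quadG
    rw [e1, e2, e3]
    simp only [Matrix.trace, Matrix.diag_apply, Matrix.mul_apply (M := Yᴴ),
      Matrix.mul_diagonal, Matrix.diagonal_mul, Matrix.conjTranspose_apply, Complex.re_sum,
      Finset.mul_sum, ← Finset.sum_sub_distrib]
    refine Finset.sum_congr rfl fun i _ => Finset.sum_congr rfl fun j _ => ?_
    simp only [Complex.normSq_apply, Complex.mul_re, Complex.mul_im, Complex.star_def,
      Complex.conj_re, Complex.conj_im, Complex.ofReal_re, Complex.ofReal_im]
    ring
  have hX : ∀ X, V * (Vᴴ * X * U) * Uᴴ = X := by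
    intro X
    calc _ = (V * Vᴴ) * X * (U * Uᴴ) := by simp only [Matrix.mul_assoc]
      _ = X := by rw [u1, v1]; simp
  have hD : qRelEnt ρ τ = ∑ i, ∑ j, Complex.normSq (W j i) *
      (p i * (Real.log (p i) - Real.log (q j))) := by
    have d1 : (ρ * matLog ρ).trace = ∑ i, ((p i * Real.log (p i) : ℝ) : ℂ) := by
      conv_lhs => rw [lU, hU]
      calc _ = (U * (Matrix.diagonal (fun i => (p i : ℂ)) * (Uᴴ * U) *
            Matrix.diagonal (fun i => (Real.log (p i) : ℂ)) * Uᴴ)).trace := by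
              simp only [Matrix.mul_assoc]
        _ = (Matrix.diagonal (fun i => (p i : ℂ)) *
            Matrix.diagonal (fun i => (Real.log (p i) : ℂ)) * (Uᴴ * U)).trace := by
              rw [Matrix.trace_mul_comm, u2]; simp only [Matrix.mul_assoc, Matrix.mul_one, u2]
        _ = _ := by
              rw [u2, Matrix.mul_one, Matrix.diagonal_mul_diagonal, Matrix.trace_diagonal]
              simp
    have d2 : (ρ * matLog τ).trace = (Matrix.diagonal (fun i => (p i : ℂ)) *
        (Wᴴ * (Matrix.diagonal (fun i => (Real.log (q i) : ℂ)) * W))).trace := by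
      conv_lhs => rw [lV, hU]
      rw [hW, Matrix.conjTranspose_mul, Matrix.conjTranspose_conjTranspose]
      calc _ = (U * (Matrix.diagonal (fun i => (p i : ℂ)) * Uᴴ * V *
            Matrix.diagonal (fun i => (Real.log (q i) : ℂ)) * Vᴴ)).trace := by
              simp only [Matrix.mul_assoc]
        _ = _ := by
              rw [Matrix.trace_mul_comm]; simp only [Matrix.mul_assoc]
    unfold qRelEnt
    rw [Matrix.mul_sub, Matrix.trace_sub, d1, d2, Complex.sub_re]
    simp only [Matrix.trace, Matrix.diag_apply, Matrix.mul_apply (M := Wᴴ),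
      Matrix.diagonal_mul, Matrix.conjTranspose_apply, Complex.re_sum, Complex.re_ofReal_mul,
      Complex.ofReal_re]
    rw [← Finset.sum_sub_distrib]
    refine Finset.sum_congr rfl fun i _ => ?_
    have : p i * Real.log (p i) = ∑ j, Complex.normSq (W j i) * (p i * Real.log (p i)) := by
      rw [← Finset.sum_mul, hsum, one_mul]
    rw [this, Finset.mul_sum, ← Finset.sum_sub_distrib]
    refine Finset.sum_congr rfl fun j _ => ?_
    simp only [Complex.normSq_apply, Complex.mul_re, Complex.mul_im, Complex.star_def,
      Complex.conj_re, Complex.conj_im, Complex.ofReal_re, Complex.ofReal_im]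
    ring
  refine ⟨fun t => ∑ i, ∑ j, Complex.normSq (W j i) * (p i ^ 2 / (q j + t * p i)),
    fun t => ∑ i, ∑ j, Complex.normSq (W j i) *
      (p i * (Real.log (q j + t * p i) - Real.log (1 + t) - Real.log (q j))), ?_, ?_, ?_, ?_, ?_⟩
  · intro t ht X
    rw [← hX X, hG]
    exact Finset.sum_le_sum fun i _ => Finset.sum_le_sum fun j _ =>
      scalar_le _ _ _ (hq j) (hp i) ht _ _
  · intro t ht
    refine ⟨V * (Matrix.of fun j i => W j i * ((p i / (q j + t * p i) : ℝ) : ℂ)) * Uᴴ, ?_⟩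
    rw [hG]
    exact Finset.sum_congr rfl fun i _ => Finset.sum_congr rfl fun j _ =>
      scalar_eq _ _ _ (hq j) (hp i) ht _
  · simp
  · intro t ht
    have : (∑ i, ∑ j, Complex.normSq (W j i) * (p i ^ 2 / (q j + t * p i))) - ρ.trace.re / (1 + t)
        = ∑ i, ∑ j, Complex.normSq (W j i) * (p i * (p i / (q j + t * p i) - 1 / (1 + t))) := by
      rw [htr, Finset.sum_div, ← Finset.sum_sub_distrib]
      refine Finset.sum_congr rfl fun i _ => ?_
      rw [Finset.sum_div, ← Finset.sum_sub_distrib]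
      refine Finset.sum_congr rfl fun j _ => ?_
      ring
    simp only
    rw [this]
    refine HasDerivAt.fun_sum fun i _ => HasDerivAt.fun_sum fun j _ => ?_
    have hs : q j + t * p i ≠ 0 := by have := hq j; have := hp i; positivity
    have hs' : 1 + t ≠ 0 := by positivity
    have a1 : HasDerivAt (fun t => Real.log (q j + t * p i)) (p i / (q j + t * p i)) t := by
      have : HasDerivAt (fun t => q j + t * p i) (p i) t := by
        simpa using ((hasDerivAt_id t).mul_const (p i)).const_add (q j)
      exact this.log hs
    have a2 : HasDerivAt (fun t => Real.log (1 + t)) (1 / (1 + t)) t :=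
      ((hasDerivAt_id t).const_add 1).log hs'
    exact (((a1.sub a2).sub_const _).const_mul _).const_mul _
  · rw [hD]
    refine tendsto_finsetSum _ fun i _ => tendsto_finsetSum _ fun j _ => ?_
    refine Filter.Tendsto.const_mul _ (Filter.Tendsto.const_mul _ (Filter.Tendsto.sub_const ?_ _))
    have hlim : Filter.Tendsto (fun t : ℝ => (q j - p i) * (1 + t)⁻¹ + p i) Filter.atTop
        (nhds (p i)) := by
      have : Filter.Tendsto (fun t : ℝ => (1 + t)⁻¹) Filter.atTop (nhds 0) :=
        tendsto_inv_atTop_zero.comp (Filter.tendsto_atTop_add_const_left _ _ Filter.tendsto_id)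
      simpa using (this.const_mul (q j - p i)).add_const (p i)
    have := hlim.log (hp i).ne'
    refine this.congr' ?_
    filter_upwards [Filter.eventually_ge_atTop 0] with t ht
    have hs : q j + t * p i ≠ 0 := by have := hq j; have := hp i; positivity
    have hs' : 1 + t ≠ 0 := by positivity
    rw [← Real.log_div hs hs']
    congr 1
    field_simp
    ring

/-- Monotonicity of the relative entropy, abstractly: `E` is a unital star-embedding and
`P` its trace dual. -/
theorem relEnt_mono {ι κ : Type*} [Fintype ι] [DecidableEq ι] [Fintype κ] [DecidableEq κ]
    (ρ τ : Matrix ι ι ℂ) (hρ : ρ.PosDef) (hτ : τ.PosDef)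
    (ρ' τ' : Matrix κ κ ℂ) (hρ' : ρ'.PosDef) (hτ' : τ'.PosDef)
    (htr : ρ.trace = ρ'.trace)
    (E : Matrix κ κ ℂ → Matrix ι ι ℂ)
    (hmul : ∀ X Y, E (X * Y) = E X * E Y) (hstar : ∀ X, E Xᴴ = (E X)ᴴ)
    (hEρ : ∀ X, (E X * ρ).trace = (X * ρ').trace)
    (hEτ : ∀ X, (E X * τ).trace = (X * τ').trace) :
    qRelEnt ρ' τ' ≤ qRelEnt ρ τ := by
  obtain ⟨F, H, h1, h2, h3, h4, h5⟩ := relEnt_repr ρ τ hρ hτ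
  obtain ⟨F', H', h1', h2', h3', h4', h5'⟩ := relEnt_repr ρ' τ' hρ' hτ'
  have hF : ∀ t, 0 ≤ t → F' t ≤ F t := by
    intro t ht
    obtain ⟨X, hX⟩ := h2' t ht
    rw [← hX]
    refine le_trans (le_of_eq ?_) (h1 t ht (E X))
    unfold quadG
    rw [← hstar, ← hmul, ← hmul, hEρ, hEτ, hEρ]
  have hd : ∀ t, 0 ≤ t → HasDerivAt (fun t => H t - H' t) (F t - F' t) t := by
    intro t ht
    have := (h4 t ht).sub (h4' t ht)
    rw [htr] at this
    have e : F t - ρ'.trace.re / (1 + t) - (F' t - ρ'.trace.re / (1 + t)) = F t - F' t := by ring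
    rw [e] at this
    exact this
  have hmono : MonotoneOn (fun t => H t - H' t) (Set.Ici 0) := by
    apply monotoneOn_of_deriv_nonneg (convex_Ici 0)
    · intro t ht
      exact (hd t ht).continuousAt.continuousWithinAt
    · intro t ht
      rw [interior_Ici] at ht
      exact (hd t (le_of_lt ht)).differentiableAt.differentiableWithinAt
    · intro t ht
      rw [interior_Ici] at ht
      rw [(hd t (le_of_lt ht)).deriv]
      have := hF t (le_of_lt ht)
      linarith
  refine le_of_tendsto_of_tendsto h5' h5 ?_
  filter_upwards [Filter.eventually_ge_atTop 0] with t ht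
  have := hmono (Set.mem_Ici.2 le_rfl) (Set.mem_Ici.2 ht) ht
  simp only [h3, h3'] at this
  linarith

theorem posDef_sum_submatrix {ι κ γ : Type*} [Fintype ι] [Fintype κ] [Fintype γ] [Nonempty γ]
    [DecidableEq γ]
    (σ : Matrix ι ι ℂ) (hσ : σ.PosDef) (e : γ → κ → ι) (he : ∀ g, Function.Injective (e g)) :
    (∑ g, σ.submatrix (e g) (e g)).PosDef := by
  classical
  obtain ⟨g⟩ := ‹Nonempty γ›
  rw [← Finset.add_sum_erase _ _ (Finset.mem_univ g)]
  refine (hσ.submatrix (he g)).add_posSemidef ?_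
  exact Matrix.posSemidef_sum _ fun i _ => hσ.posSemidef.submatrix _

section

variable {A B C : Type*} [Fintype A] [DecidableEq A] [Fintype B] [DecidableEq B]
  [Fintype C] [DecidableEq C]

theorem margAC_posDef [Nonempty B] (σ : Matrix (A × B × C) (A × B × C) ℂ) (hσ : σ.PosDef) :
    (margAC σ).PosDef := by
  have := posDef_sum_submatrix (κ := A × C) σ hσ (fun (j : B) x => (x.1, j, x.2))
    (by rintro g ⟨a, b⟩ ⟨c, d⟩ h; simpa using h)
  convert this using 1
  ext x y
  simp [margAC, Matrix.sum_apply]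

theorem margBC_posDef [Nonempty A] (σ : Matrix (A × B × C) (A × B × C) ℂ) (hσ : σ.PosDef) :
    (margBC σ).PosDef := by
  have := posDef_sum_submatrix (κ := B × C) σ hσ (fun (j : A) x => (j, x.1, x.2))
    (by rintro g ⟨a, b⟩ ⟨c, d⟩ h; simpa using h)
  convert this using 1
  ext x y
  simp [margBC, Matrix.sum_apply]

theorem margA_posDef [Nonempty B] [Nonempty C] (σ : Matrix (A × B × C) (A × B × C) ℂ)
    (hσ : σ.PosDef) : (margA σ).PosDef := by
  have := posDef_sum_submatrix (κ := A) σ hσ (fun (j : B × C) x => (x, j.1, j.2))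
    (by intro g a c h; simpa using h)
  convert this using 1
  ext x y
  simp [margA, Matrix.sum_apply, Fintype.sum_prod_type]

theorem margB_posDef [Nonempty A] [Nonempty C] (σ : Matrix (A × B × C) (A × B × C) ℂ)
    (hσ : σ.PosDef) : (margB σ).PosDef := by
  have := posDef_sum_submatrix (κ := B) σ hσ (fun (j : A × C) x => (j.1, x, j.2))
    (by intro g a c h; simpa using h)
  convert this using 1
  ext x y
  simp [margB, Matrix.sum_apply, Fintype.sum_prod_type]

theorem margC_posDef [Nonempty A] [Nonempty B] (σ : Matrix (A × B × C) (A × B × C) ℂ)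
    (hσ : σ.PosDef) : (margC σ).PosDef := by
  have := posDef_sum_submatrix (κ := C) σ hσ (fun (j : A × B) x => (j.1, j.2, x))
    (by intro g a c h; simpa using h)
  convert this using 1
  ext x y
  simp [margC, Matrix.sum_apply, Fintype.sum_prod_type]

/-- Reordering of the tensor factors. -/
def eABC (A B C : Type*) : A × B × C ≃ (A × C) × B where
  toFun x := ((x.1, x.2.2), x.2.1)
  invFun x := (x.1.1, x.2, x.1.2)
  left_inv _ := rfl
  right_inv _ := rfl

/-- Embedding `X ↦ X_{AC} ⊗ 1_B`. -/
noncomputable def embAC (X : Matrix (A × C) (A × C) ℂ) : Matrix (A × B × C) (A × B × C) ℂ :=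
  (X ⊗ₖ (1 : Matrix B B ℂ)).submatrix (eABC A B C) (eABC A B C)

theorem embAC_mul (X Y : Matrix (A × C) (A × C) ℂ) :
    (embAC (X * Y) : Matrix (A × B × C) (A × B × C) ℂ) = embAC X * embAC Y := by
  unfold embAC
  rw [Matrix.submatrix_mul_equiv, ← Matrix.mul_kronecker_mul, Matrix.mul_one]

theorem embAC_star (X : Matrix (A × C) (A × C) ℂ) :
    (embAC Xᴴ : Matrix (A × B × C) (A × B × C) ℂ) = (embAC X)ᴴ := by
  unfold embAC
  rw [Matrix.conjTranspose_submatrix, Matrix.conjTranspose_kronecker, Matrix.conjTranspose_one]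

theorem embAC_trace (X : Matrix (A × C) (A × C) ℂ) (M : Matrix (A × B × C) (A × B × C) ℂ) :
    (embAC X * M).trace = (X * margAC M).trace := by
  have h : (embAC X * M).trace = ∑ x : (A × C) × B, ∑ y : (A × C) × B,
      (X ⊗ₖ (1 : Matrix B B ℂ)) x y * M ((eABC A B C).symm y) ((eABC A B C).symm x) := by
    simp only [Matrix.trace, Matrix.diag_apply, Matrix.mul_apply]
    rw [← Equiv.sum_comp (eABC A B C)]
    refine Finset.sum_congr rfl fun x _ => ?_
    rw [← Equiv.sum_comp (eABC A B C)]
    rfl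
  rw [h]
  simp only [Matrix.trace, Matrix.diag_apply, Matrix.mul_apply]
  rw [Fintype.sum_prod_type]
  refine Finset.sum_congr rfl fun x _ => ?_
  simp only [Fintype.sum_prod_type (α₁ := A × C), Matrix.kronecker_apply, Matrix.one_apply]
  rw [Finset.sum_comm]
  refine Finset.sum_congr rfl fun y _ => ?_
  simp [margAC, Finset.mul_sum, eABC]

theorem margBC_trace (X : Matrix (B × C) (B × C) ℂ) (M : Matrix (A × B × C) (A × B × C) ℂ) :
    (M * ((1 : Matrix A A ℂ) ⊗ₖ X)).trace = (margBC M * X).trace := by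
  simp only [Matrix.trace, Matrix.diag_apply, Matrix.mul_apply, margBC, Matrix.of_apply]
  rw [Fintype.sum_prod_type, Finset.sum_comm]
  refine Finset.sum_congr rfl fun x _ => ?_
  simp only [Fintype.sum_prod_type (α₁ := A), Matrix.kronecker_apply, Matrix.one_apply]
  simp only [Finset.sum_mul]
  rw [Finset.sum_comm (γ := A)]
  conv_rhs => rw [Finset.sum_comm]
  simp [Finset.sum_ite_eq]

theorem margAC_trace (M : Matrix (A × B × C) (A × B × C) ℂ) :
    M.trace = (margAC M).trace := by
  simp only [Matrix.trace, Matrix.diag_apply, margAC, Matrix.of_apply, Fintype.sum_prod_type]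
  exact Finset.sum_congr rfl fun x _ => Finset.sum_comm

theorem margAC_prod (M : Matrix (A × B × C) (A × B × C) ℂ) :
    margAC (margA M ⊗ₖ margBC M) = margA M ⊗ₖ margC M := by
  ext x y
  simp only [margAC, Matrix.of_apply, Matrix.kronecker_apply, ← Finset.mul_sum]
  congr 1
  simp only [margBC, margC, Matrix.of_apply]
  exact Finset.sum_comm

end

end Helpers

/-- nonnegativity of conditional mutual information. For a positive
definite density matrix `σ` on a tripartite space `A × B × C`,
`I_σ(A;B|C) = D(σ ‖ σ_A ⊗ σ_B ⊗ σ_C) - D(σ_AC ‖ σ_A ⊗ σ_C) - D(σ_BC ‖ σ_B ⊗ σ_C) ≥ 0`. -/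
theorem condMutualInfo_nonneg {A B C : Type*}
    [Fintype A] [DecidableEq A] [Fintype B] [DecidableEq B] [Fintype C] [DecidableEq C]
    (σ : Matrix (A × B × C) (A × B × C) ℂ)
    (hσ : σ.PosDef) (hσtr : σ.trace = 1) :
    qRelEnt σ (margA σ ⊗ₖ (margB σ ⊗ₖ margC σ))
      - qRelEnt (margAC σ) (margA σ ⊗ₖ margC σ)
      - qRelEnt (margBC σ) (margB σ ⊗ₖ margC σ) ≥ 0 := by
  have hne : Nonempty (A × B × C) := by
    by_contra h
    rw [not_nonempty_iff] at h
    simp [Matrix.trace] at hσtr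
  obtain ⟨a, b, c⟩ := hne
  haveI : Nonempty A := ⟨a⟩
  haveI : Nonempty B := ⟨b⟩
  haveI : Nonempty C := ⟨c⟩
  have pA := margA_posDef σ hσ
  have pB := margB_posDef σ hσ
  have pC := margC_posDef σ hσ
  have pAC := margAC_posDef σ hσ
  have pBC := margBC_posDef σ hσ
  have hmono := relEnt_mono σ (margA σ ⊗ₖ margBC σ) hσ (pA.kronecker pBC)
    (margAC σ) (margA σ ⊗ₖ margC σ) pAC (pA.kronecker pC) (margAC_trace σ)
    embAC embAC_mul embAC_star (fun X => embAC_trace X σ)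
    (fun X => by rw [embAC_trace, margAC_prod])
  have hsplit : qRelEnt σ (margA σ ⊗ₖ (margB σ ⊗ₖ margC σ))
      = qRelEnt σ (margA σ ⊗ₖ margBC σ) + qRelEnt (margBC σ) (margB σ ⊗ₖ margC σ) := by
    unfold qRelEnt
    rw [← Complex.add_re, ← margBC_trace, ← Matrix.trace_add, ← Matrix.mul_add,
      matLog_kronecker_s14 _ _ pA (pB.kronecker pC), matLog_kronecker_s14 _ _ pA pBC,
      sub_eq_add_neg (matLog (margBC σ)), Matrix.kronecker_add]
    have : (1 : Matrix A A ℂ) ⊗ₖ (-matLog (margB σ ⊗ₖ margC σ))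
        = -((1 : Matrix A A ℂ) ⊗ₖ matLog (margB σ ⊗ₖ margC σ)) := by
      ext x y
      simp [Matrix.kronecker_apply]
    rw [this]
    congr 3
    abel
  linarith
end

section
/- Let n ≥ 3 and let Δ = {p ∈ ℝⁿ : pᵢ ≥ 0, ∑ᵢ pᵢ = 1} be the probability simplex. Let F : Δ → ℝ be continuous, strictly convex on Δ, and Fréchet differentiable at every point of Δ with full support (all coordinates positive), and define the Bregman divergence D_F(p, q) = F(p) − F(q) − (DF(q))(p − q) whenever q has full support. Suppose D_F satisfies statistical locality: for all p, q₁, q₂ ∈ Δ such that the support of each qᵢ is the complement of the support of p, and for all t ∈ (0,1), D_F(p, (1−t)·p + t·q₁) = D_F(p, (1−t)·p + t·q₂). Then there exist a constant c > 0 and an affine function A : ℝⁿ → ℝ such that F(p) = c·∑ᵢ pᵢ log pᵢ + A(p) for all p ∈ Δ (with the convention 0 log 0 = 0); equivalently, D_F is proportional to the Kullback–Leibler divergence. -/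
open Finset Filter Topology

namespace StatLoc

/-- Open simplex membership. -/
def Inner {n : ℕ} (r : Fin n → ℝ) : Prop := (∀ i, 0 < r i) ∧ ∑ i, r i = 1

lemma sum_split {n : ℕ} (f : Fin n → ℝ) {i j : Fin n} (hij : i ≠ j) :
    ∑ k, f k = f i + (f j + ∑ k ∈ (univ.erase i).erase j, f k) := by
  rw [Finset.add_sum_erase (univ.erase i) f (by simp [hij.symm]),
    Finset.add_sum_erase univ f (mem_univ i)]

/-- The point with prescribed coordinates `i`, `j`, the others equal. -/
noncomputable def pt {n : ℕ} (i j : Fin n) (x y : ℝ) : Fin n → ℝ :=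
  fun k => if k = i then x else if k = j then y else (1 - x - y) / ((n : ℝ) - 2)

lemma pt_i {n : ℕ} (i j : Fin n) (x y : ℝ) : pt i j x y i = x := by simp [pt]

lemma pt_j {n : ℕ} {i j : Fin n} (hij : i ≠ j) (x y : ℝ) : pt i j x y j = y := by
  simp [pt, hij.symm]

lemma pt_k {n : ℕ} {i j k : Fin n} (hi : k ≠ i) (hj : k ≠ j) (x y : ℝ) :
    pt i j x y k = (1 - x - y) / ((n : ℝ) - 2) := by
  simp [pt, hi, hj]

lemma pt_inner {n : ℕ} (hn : 3 ≤ n) {i j : Fin n} (hij : i ≠ j) {x y : ℝ}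
    (hx : 0 < x) (hy : 0 < y) (hxy : x + y < 1) : Inner (pt i j x y) := by
  have hn' : (3 : ℝ) ≤ n := by exact_mod_cast hn
  constructor
  · intro k
    unfold pt
    split_ifs
    · exact hx
    · exact hy
    · apply div_pos <;> linarith
  · rw [sum_split _ hij, pt_i, pt_j hij]
    have : ∑ k ∈ (univ.erase i).erase j, pt i j x y k
        = ∑ k ∈ (univ.erase i).erase j, (1 - x - y) / ((n : ℝ) - 2) := by
      apply Finset.sum_congr rfl
      intro k hk
      simp only [mem_erase, mem_univ, and_true] at hk
      exact pt_k hk.2 hk.1 x y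
    rw [this, Finset.sum_const, Finset.card_erase_of_mem (by simp [hij.symm]),
      Finset.card_erase_of_mem (mem_univ i), Finset.card_univ, Fintype.card_fin, nsmul_eq_mul,
      show n - 1 - 1 = n - 2 by omega, Nat.cast_sub (by omega)]
    have : (n : ℝ) - 2 ≠ 0 := by linarith
    push_cast
    field_simp
    ring

lemma pt_line {n : ℕ} {i j : Fin n} (hij : i ≠ j) (x y s : ℝ) :
    pt i j (x + s) (y - s)
      = pt i j x y + s • ((Pi.single i 1 : Fin n → ℝ) - Pi.single j 1) := by
  funext k
  by_cases hi : k = i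
  · subst hi; simp [pt, hij]
  by_cases hj : k = j
  · subst hj; simp [pt, hij.symm]; ring
  simp [pt, hi, hj]
  congr 1
  ring

/-- Derivative along a line inside the hyperplane. -/
lemma line_deriv {n : ℕ} (F : (Fin n → ℝ) → ℝ) (r v : Fin n → ℝ) (l : (Fin n → ℝ) →L[ℝ] ℝ)
    (hr : ∑ i, r i = 1) (hv : ∑ i, v i = 0)
    (h : HasFDerivWithinAt F l {x : Fin n → ℝ | ∑ i, x i = 1} r) :
    HasDerivAt (fun s : ℝ => F (r + s • v)) (l v) 0 := by
  have hg : HasDerivWithinAt (fun s : ℝ => r + s • v) v Set.univ 0 := by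
    have : HasDerivAt (fun s : ℝ => r + s • v) ((1 : ℝ) • v) 0 :=
      ((hasDerivAt_id (0 : ℝ)).smul_const v).const_add r
    rw [one_smul] at this
    exact this.hasDerivWithinAt
  have h' : HasFDerivWithinAt F l {x : Fin n → ℝ | ∑ i, x i = 1} ((fun s : ℝ => r + s • v) 0) := by
    simpa using h
  have := h'.comp_hasDerivWithinAt (0 : ℝ) hg (t := {x : Fin n → ℝ | ∑ i, x i = 1}) (by
    intro s _
    simp [Finset.sum_add_distrib, ← Finset.mul_sum, hr, hv])
  exact hasDerivWithinAt_univ.1 this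

lemma grad_ineq {n : ℕ} (F : (Fin n → ℝ) → ℝ) (l : (Fin n → ℝ) →L[ℝ] ℝ)
    (hconv : ConvexOn ℝ {p : Fin n → ℝ | (∀ i, 0 ≤ p i) ∧ ∑ i, p i = 1} F)
    {r r' : Fin n → ℝ} (hr : Inner r) (hr' : Inner r')
    (h : HasFDerivWithinAt F l {x : Fin n → ℝ | ∑ i, x i = 1} r) :
    F r + l (r' - r) ≤ F r' := by
  have hd := line_deriv F r (r' - r) l hr.2 (by simp [hr.2, hr'.2]) h
  have ht := hd.tendsto_slope_zero_right
  have : l (r' - r) ≤ F r' - F r := by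
    refine le_of_tendsto ht ?_
    filter_upwards [Ioc_mem_nhdsGT (zero_lt_one (α := ℝ))] with t ht
    have hc := hconv.2 (show r ∈ _ from ⟨fun i => (hr.1 i).le, hr.2⟩)
      (show r' ∈ _ from ⟨fun i => (hr'.1 i).le, hr'.2⟩) (sub_nonneg.2 ht.2) ht.1.le
      (sub_add_cancel 1 t)
    have e : (1 - t) • r + t • r' = r + t • (r' - r) := by
      funext k; simp; ring
    rw [e] at hc
    simp only [zero_add, zero_smul, add_zero, smul_eq_mul] at hc ⊢
    rw [inv_mul_le_iff₀ ht.1]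
    linarith
  linarith

/-- Key step: transfer of differentiability between coordinates. -/
lemma transfer {n : ℕ} (hn : 3 ≤ n) (F : (Fin n → ℝ) → ℝ)
    (L : (Fin n → ℝ) → ((Fin n → ℝ) →L[ℝ] ℝ))
    (hdiff : ∀ q : Fin n → ℝ, Inner q →
      HasFDerivWithinAt F (L q) {x : Fin n → ℝ | ∑ i, x i = 1} q)
    (h : Fin n → ℝ → ℝ)
    (hh : ∀ r, Inner r → ∀ i, F r + L r (Pi.single i 1 - r) = h i (r i))
    (hF : ∀ r, Inner r → F r = ∑ i, r i * h i (r i))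
    {i j : Fin n} (hij : i ≠ j) {x y c : ℝ} (hx : 0 < x) (hy : 0 < y) (hxy : x + y < 1)
    (hj : HasDerivAt (h j) (c / y) y) : HasDerivAt (h i) (c / x) x := by
  have hr := pt_inner hn hij hx hy hxy
  have hd := line_deriv F (pt i j x y) (Pi.single i 1 - Pi.single j 1) _ hr.2 (by simp)
    (hdiff _ hr)
  have hL : L (pt i j x y) (Pi.single i 1 - Pi.single j 1) = h i x - h j y := by
    have h1 := hh _ hr i
    have h2 := hh _ hr j
    rw [pt_i] at h1
    rw [pt_j hij] at h2
    rw [← h1, ← h2, map_sub, map_sub, map_sub]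
    ring
  rw [hL] at hd
  simp only [← pt_line hij] at hd
  -- the part of the sum not depending on `s`
  set C : ℝ := ∑ k ∈ (univ.erase i).erase j,
    (1 - x - y) / ((n : ℝ) - 2) * h k ((1 - x - y) / ((n : ℝ) - 2)) with hC
  have hev : (fun s : ℝ => F (pt i j (x + s) (y - s))) =ᶠ[𝓝 0]
      fun s => (x + s) * h i (x + s) + ((y - s) * h j (y - s) + C) := by
    have hx' : ∀ᶠ s : ℝ in 𝓝 0, -x < s := lt_mem_nhds (by linarith)
    have hy' : ∀ᶠ s : ℝ in 𝓝 0, s < y := gt_mem_nhds hy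
    filter_upwards [hx', hy'] with s h1 h2
    have hin := pt_inner hn hij (x := x + s) (y := y - s) (by linarith) (by linarith)
      (by linarith)
    rw [hF _ hin, sum_split _ hij, pt_i, pt_j hij]
    congr 2
    apply Finset.sum_congr rfl
    intro k hk
    simp only [mem_erase, mem_univ, and_true] at hk
    rw [pt_k hk.2 hk.1, show 1 - (x + s) - (y - s) = 1 - x - y by ring]
  have hd2 := hd.congr_of_eventuallyEq hev.symm
  have hj0 : HasDerivAt (fun z => z * h j z) (1 * h j y + y * (c / y)) y :=
    (hasDerivAt_id y).mul hj
  have hj1 : HasDerivAt (fun s : ℝ => (y - s) * h j (y - s))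
      ((1 * h j y + y * (c / y)) * (-1)) 0 := by
    have hj0' : HasDerivAt (fun z => z * h j z) (1 * h j y + y * (c / y)) (y - 0) := by
      simpa using hj0
    exact hj0'.comp (0 : ℝ) ((hasDerivAt_id (0 : ℝ)).const_sub y)
  have hi1 := hd2.sub (hj1.add_const C)
  have hi2 : HasDerivAt (fun s : ℝ => (x + s) * h i (x + s)) (h i x + c) 0 := by
    have e : h i x - h j y - (1 * h j y + y * (c / y)) * (-1) = h i x + c := by
      field_simp; ring
    rw [e] at hi1
    refine hi1.congr_of_eventuallyEq (Filter.Eventually.of_forall fun s => ?_)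
    simp
  have hi3 : HasDerivAt (fun z => z * h i z) (h i x + c) x := by
    have hi2' : HasDerivAt (fun s : ℝ => (x + s) * h i (x + s)) (h i x + c) (x - x) := by
      simpa using hi2
    have hs : HasDerivAt (fun z : ℝ => z - x) 1 x := (hasDerivAt_id x).sub_const x
    have := HasDerivAt.comp (h := fun z : ℝ => z - x) x hi2' hs
    simpa [Function.comp_def] using this
  have hi4 := hi3.div (hasDerivAt_id x) hx.ne'
  have hi5 : HasDerivAt (h i) (((h i x + c) * id x - x * h i x * 1) / id x ^ 2) x := by
    refine hi4.congr_of_eventuallyEq ?_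
    filter_upwards [lt_mem_nhds hx] with z hz
    simp [hz.ne']
  convert hi5 using 1
  simp only [id]
  field_simp
  ring

end StatLoc

open StatLoc in
/-- characterization of entropy by statistical locality on the
probability simplex. Let `n ≥ 3` and let `Δ` be the probability simplex in `ℝⁿ`.
Let `F` be continuous on `Δ`, strictly convex on `Δ`, and Fréchet differentiable
(within the affine hyperplane `∑ i, x i = 1`) at every point of `Δ` with full
support, with derivative `L q` there; set `D_F (p, q) = F p - F q - L q (p - q)`.
If `D_F` satisfies statistical locality — for all `p, q₁, q₂ ∈ Δ` such that the
support of each `qᵢ` is the complement of the support of `p`, and all `t ∈ (0,1)`,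
`D_F (p, (1-t)•p + t•q₁) = D_F (p, (1-t)•p + t•q₂)` — then there exist `c > 0` and
an affine function `A : ℝⁿ → ℝ` with `F p = c • ∑ i, p i * log (p i) + A p` on `Δ`
(so `D_F` is proportional to the Kullback–Leibler divergence). -/
theorem statistical_locality_characterizes_entropy
    (n : ℕ) (hn : 3 ≤ n)
    (F : (Fin n → ℝ) → ℝ)
    (L : (Fin n → ℝ) → ((Fin n → ℝ) →L[ℝ] ℝ))
    (hcont : ContinuousOn F {p : Fin n → ℝ | (∀ i, 0 ≤ p i) ∧ ∑ i, p i = 1})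
    (hconv : StrictConvexOn ℝ {p : Fin n → ℝ | (∀ i, 0 ≤ p i) ∧ ∑ i, p i = 1} F)
    (hdiff : ∀ q : Fin n → ℝ, (∀ i, 0 < q i) → ∑ i, q i = 1 →
      HasFDerivWithinAt F (L q) {x : Fin n → ℝ | ∑ i, x i = 1} q)
    (hloc : ∀ p q₁ q₂ : Fin n → ℝ,
      ((∀ i, 0 ≤ p i) ∧ ∑ i, p i = 1) →
      ((∀ i, 0 ≤ q₁ i) ∧ ∑ i, q₁ i = 1) →
      ((∀ i, 0 ≤ q₂ i) ∧ ∑ i, q₂ i = 1) →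
      (∀ i, 0 < q₁ i ↔ p i = 0) →
      (∀ i, 0 < q₂ i ↔ p i = 0) →
      ∀ t : ℝ, 0 < t → t < 1 →
        (F p - F ((1 - t) • p + t • q₁)
            - L ((1 - t) • p + t • q₁) (p - ((1 - t) • p + t • q₁))) =
        (F p - F ((1 - t) • p + t • q₂)
            - L ((1 - t) • p + t • q₂) (p - ((1 - t) • p + t • q₂)))) :
    ∃ (c : ℝ) (A : (Fin n → ℝ) →ᵃ[ℝ] ℝ), 0 < c ∧
      ∀ p : Fin n → ℝ, (∀ i, 0 ≤ p i) → ∑ i, p i = 1 →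
        F p = c * (∑ i, p i * Real.log (p i)) + A p := by
  have hdiff' : ∀ q : Fin n → ℝ, Inner q →
      HasFDerivWithinAt F (L q) {x : Fin n → ℝ | ∑ i, x i = 1} q :=
    fun q hq => hdiff q hq.1 hq.2
  have hn' : (3 : ℝ) ≤ n := by exact_mod_cast hn
  -- other index
  have hother : ∀ i : Fin n, ∃ j, i ≠ j := by
    intro i
    by_cases h0 : i = ⟨0, by omega⟩
    · exact ⟨⟨1, by omega⟩, by rw [h0]; simp⟩
    · exact ⟨_, h0⟩
  have hlt1 : ∀ r : Fin n → ℝ, Inner r → ∀ i, r i < 1 := by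
    intro r hr i
    obtain ⟨j, hij⟩ := hother i
    have h1 := sum_split r hij
    have h2 : 0 ≤ ∑ k ∈ (univ.erase i).erase j, r k :=
      Finset.sum_nonneg fun k _ => (hr.1 k).le
    have := hr.1 j
    linarith [hr.2]
  -- locality at vertices
  have hvert : ∀ r r' : Fin n → ℝ, Inner r → Inner r' → ∀ i, r i = r' i →
      F r + L r (Pi.single i 1 - r) = F r' + L r' (Pi.single i 1 - r') := by
    intro r r' hr hr' i hi
    have hlt := hlt1 r hr i
    have ht : 0 < 1 - r i := by linarith
    have key : ∀ u : Fin n → ℝ, Inner u → u i = r i →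
        ((∀ k, 0 ≤ ((1 - r i)⁻¹ • (u - (Pi.single i (r i) : Fin n → ℝ))) k) ∧
          ∑ k, ((1 - r i)⁻¹ • (u - (Pi.single i (r i) : Fin n → ℝ))) k = 1) ∧
        (∀ k, 0 < ((1 - r i)⁻¹ • (u - (Pi.single i (r i) : Fin n → ℝ))) k ↔
          (Pi.single i 1 : Fin n → ℝ) k = 0) ∧
        (1 - (1 - r i)) • (Pi.single i 1 : Fin n → ℝ)
          + (1 - r i) • ((1 - r i)⁻¹ • (u - (Pi.single i (r i) : Fin n → ℝ))) = u := by
      intro u hu hui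
      refine ⟨⟨?_, ?_⟩, ?_, ?_⟩
      · intro k
        by_cases hk : k = i
        · subst hk; simp [hui]
        · simp only [Pi.smul_apply, Pi.sub_apply, Pi.single_apply, hk, if_false, sub_zero, smul_eq_mul]
          have := hu.1 k
          positivity
      · simp only [Pi.smul_apply, Pi.sub_apply, smul_eq_mul, ← Finset.mul_sum,
          Finset.sum_sub_distrib, hu.2, Finset.sum_pi_single', Finset.mem_univ, if_true,
          Finset.univ_sum_single, Finset.sum_pi_single]
        field_simp
      · intro k
        by_cases hk : k = i
        · subst hk; simp [hui]
        · simp only [Pi.smul_apply, Pi.sub_apply, Pi.single_apply, hk, if_false, sub_zero, smul_eq_mul]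
          have := hu.1 k
          simp only [iff_true]
          positivity
      · rw [smul_inv_smul₀ ht.ne']
        funext k
        by_cases hk : k = i
        · subst hk; simp
        · simp [hk]
    obtain ⟨a1, a2, a3⟩ := key r hr rfl
    obtain ⟨b1, b2, b3⟩ := key r' hr' hi.symm
    have := hloc (Pi.single i 1) _ _ ⟨fun k => by
        by_cases hk : k = i
        · subst hk; simp
        · simp [hk], by simp⟩ a1 b1 a2 b2 (1 - r i) ht (by linarith [hr.1 i])
    rw [a3, b3] at this
    linarith
  -- the functions h
  obtain ⟨h, hh⟩ : ∃ h : Fin n → ℝ → ℝ, ∀ r, Inner r → ∀ i,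
      F r + L r (Pi.single i 1 - r) = h i (r i) := by
    choose o ho using hother
    refine ⟨fun i x => F (pt i (o i) x ((1 - x) / 2))
      + L (pt i (o i) x ((1 - x) / 2)) (Pi.single i 1 - pt i (o i) x ((1 - x) / 2)), ?_⟩
    intro r hr i
    have := hlt1 r hr i
    exact hvert _ _ hr (pt_inner hn (ho i) (hr.1 i) (by linarith) (by linarith)) i
      (pt_i _ _ _ _).symm
  have hF : ∀ r, Inner r → F r = ∑ i, r i * h i (r i) := by
    intro r hr
    simp only [← hh r hr, map_sub, mul_add, mul_sub, Finset.sum_add_distrib,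
      Finset.sum_sub_distrib, ← Finset.sum_mul, hr.2]
    have : ∑ i, r i * L r (Pi.single i 1) = L r r := by
      have hr0 : r = ∑ i, r i • (Pi.single i 1 : Fin n → ℝ) := by
        funext k
        simp [Finset.sum_apply, Pi.single_apply]
      have := congrArg (L r) hr0
      rw [map_sum] at this
      simpa using this.symm
    rw [this]; ring
  -- monotonicity
  have hmono : ∀ i, MonotoneOn (h i) (Set.Ioo 0 1) := by
    intro i x hx x' hx' hxx
    obtain ⟨j, hij⟩ := hother i
    have hr := pt_inner hn hij (x := x) (y := (1 - x) / 2) hx.1 (by linarith [hx.2])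
      (by linarith [hx.2])
    have hr' := pt_inner hn hij (x := x') (y := (1 - x') / 2) hx'.1 (by linarith [hx'.2])
      (by linarith [hx'.2])
    have e1 := hh _ hr i
    have e2 := hh _ hr' i
    rw [pt_i] at e1 e2
    rw [← e1, ← e2]
    have hk : pt i j x' ((1 - x') / 2) - pt i j x ((1 - x) / 2)
        = ((x' - x) / (1 - x')) • (Pi.single i 1 - pt i j x' ((1 - x') / 2)) := by
      have h1 : 1 - x' ≠ 0 := by linarith [hx'.2]
      have h2 : (n : ℝ) - 2 ≠ 0 := by linarith
      funext k
      by_cases hi : k = i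
      · subst hi; simp [pt]; field_simp
      by_cases hj : k = j
      · subst hj; simp [pt, hij.symm]; field_simp; ring
      · simp [pt, hi, hj]; field_simp; ring
    set r := pt i j x ((1 - x) / 2)
    set r' := pt i j x' ((1 - x') / 2)
    have g1 := grad_ineq F _ hconv.convexOn hr hr' (hdiff' r hr)
    have g2 := grad_ineq F _ hconv.convexOn hr' hr (hdiff' r' hr')
    set v : Fin n → ℝ := Pi.single i 1 - r' with hv
    set κ := (x' - x) / (1 - x') with hκ
    have e3 : Pi.single i 1 - r = v + κ • v := by rw [← hk, hv]; abel
    have e4 : r - r' = -(κ • v) := by rw [← hk]; abel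
    rw [hk] at g1
    rw [e4] at g2
    rw [e3]
    simp only [map_neg, map_add, map_smul, smul_eq_mul] at g1 g2 ⊢
    rcases hxx.eq_or_lt with heq | hlt
    · subst heq
      have : r = r' := rfl
      have hκ0 : κ = 0 := by rw [hκ]; simp
      rw [this, hκ0]; simp
    · have hκp : 0 < κ := div_pos (by linarith) (by linarith [hx'.2])
      have : κ * L r v ≤ κ * L r' v := by linarith
      have := le_of_mul_le_mul_left this hκp
      linarith
  -- a point of differentiability
  have i0 : Fin n := ⟨0, by omega⟩
  obtain ⟨i1, hi01⟩ := hother i0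
  obtain ⟨y0, hy0, d, hd⟩ : ∃ y0 ∈ Set.Ioo (0 : ℝ) 1, ∃ d, HasDerivAt (h i0) d y0 := by
    have hae := (hmono i0).ae_differentiableWithinAt measurableSet_Ioo
    have hne : (MeasureTheory.ae (MeasureTheory.volume.restrict (Set.Ioo (0 : ℝ) 1))).NeBot := by
      rw [MeasureTheory.ae_neBot, ne_eq, MeasureTheory.Measure.restrict_eq_zero]
      simp
    obtain ⟨y, hy1, hy2⟩ := (hae.and (MeasureTheory.ae_restrict_mem measurableSet_Ioo)).exists
    exact ⟨y, hy2, _, (hy1.differentiableAt (isOpen_Ioo.mem_nhds hy2)).hasDerivAt⟩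
  obtain ⟨c, hc⟩ : ∃ c, c = d * y0 := ⟨_, rfl⟩
  have hd0 : HasDerivAt (h i0) (c / y0) y0 := by
    rw [hc, mul_div_cancel_right₀ _ hy0.1.ne']; exact hd
  have s1 : ∀ x, 0 < x → x < 1 - y0 → HasDerivAt (h i1) (c / x) x := fun x hx hx1 =>
    transfer hn F L hdiff' h hh hF hi01.symm hx hy0.1 (by linarith) hd0
  have s2 : ∀ k, k ≠ i1 → ∀ z ∈ Set.Ioo (0 : ℝ) 1, HasDerivAt (h k) (c / z) z := by
    intro k hk z hz
    have hm : 0 < min (1 - y0) (1 - z) := lt_min (by linarith [hy0.2]) (by linarith [hz.2])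
    have m1 := min_le_left (1 - y0) (1 - z)
    have m2 := min_le_right (1 - y0) (1 - z)
    exact transfer hn F L hdiff' h hh hF hk hz.1 (y := min (1 - y0) (1 - z) / 2) (by linarith)
      (by linarith) (s1 _ (by linarith) (by linarith))
  have s3 : ∀ k, ∀ z ∈ Set.Ioo (0 : ℝ) 1, HasDerivAt (h k) (c / z) z := by
    intro k z hz
    by_cases hk : k = i1
    · subst hk
      exact transfer hn F L hdiff' h hh hF hi01.symm hz.1 (y := (1 - z) / 2)
        (by linarith [hz.2]) (by linarith [hz.2])
        (s2 i0 hi01 _ ⟨by linarith [hz.2], by linarith [hz.1]⟩)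
    · exact s2 k hk z hz
  have s4 : ∀ k, ∃ b, ∀ z ∈ Set.Ioo (0 : ℝ) 1, h k z = c * Real.log z + b := by
    intro k
    have hD : ∀ z ∈ Set.Ioo (0 : ℝ) 1, HasDerivAt (fun z => h k z - c * Real.log z) 0 z := by
      intro z hz
      have := (s3 k z hz).sub ((Real.hasDerivAt_log hz.1.ne').const_mul c)
      rw [div_eq_mul_inv, sub_self] at this
      exact this
    refine ⟨h k (1/2) - c * Real.log (1/2), fun z hz => ?_⟩
    have := isOpen_Ioo.is_const_of_deriv_eq_zero isPreconnected_Ioo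
      (fun z hz => (hD z hz).differentiableAt.differentiableWithinAt)
      (fun z hz => (hD z hz).deriv) hz (show (1/2 : ℝ) ∈ Set.Ioo (0 : ℝ) 1 by norm_num)
    linarith
  choose b hb using s4
  have hc0 : 0 ≤ c := by
    have h1 := hmono i0 (show (1/4 : ℝ) ∈ Set.Ioo (0 : ℝ) 1 by norm_num)
      (show (1/2 : ℝ) ∈ Set.Ioo (0 : ℝ) 1 by norm_num) (by norm_num)
    rw [hb i0 _ (by norm_num), hb i0 _ (by norm_num)] at h1
    have h2 : Real.log (1/4) < Real.log (1/2) := Real.log_lt_log (by norm_num) (by norm_num)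
    nlinarith
  let A : (Fin n → ℝ) →ₗ[ℝ] ℝ := ∑ i, b i • LinearMap.proj i
  have hA : ∀ p, A p = ∑ i, b i * p i := by intro p; simp [A]
  have hFin : ∀ r, Inner r → F r = c * (∑ i, r i * Real.log (r i)) + A r := by
    intro r hr
    rw [hF r hr, hA, Finset.mul_sum, ← Finset.sum_add_distrib]
    apply Finset.sum_congr rfl
    intro i _
    rw [hb i _ ⟨hr.1 i, hlt1 r hr i⟩]; ring
  have hall : ∀ p : Fin n → ℝ, (∀ i, 0 ≤ p i) → ∑ i, p i = 1 →
      F p = c * (∑ i, p i * Real.log (p i)) + A p := by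
    intro p hp hp1
    let u : Fin n → ℝ := fun _ => (n : ℝ)⁻¹
    have hu : Inner u := ⟨fun i => by simp only [u]; positivity, by simp [u]; field_simp⟩
    let γ : ℝ → Fin n → ℝ := fun t => (1 - t) • p + t • u
    have hγc : Continuous γ := by fun_prop
    have hγ0 : γ 0 = p := by simp [γ]
    have hγin : ∀ t ∈ Set.Ioc (0 : ℝ) 1, Inner (γ t) := by
      intro t ht
      refine ⟨fun i => ?_, ?_⟩
      · have h1 := hp i
        have h2 := hu.1 i
        have h3 : 0 < t * u i := mul_pos ht.1 h2
        have h4 : 0 ≤ (1 - t) * p i := mul_nonneg (by linarith [ht.2]) h1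
        simp only [γ, Pi.add_apply, Pi.smul_apply, smul_eq_mul]
        linarith
      · simp only [γ, Pi.add_apply, Pi.smul_apply, smul_eq_mul, Finset.sum_add_distrib,
          ← Finset.mul_sum, hp1, hu.2]
        ring
    have hγt : Tendsto γ (𝓝[>] 0) (𝓝 p) := by
      rw [← hγ0]; exact hγc.continuousAt.tendsto.mono_left nhdsWithin_le_nhds
    have hev : ∀ᶠ t in 𝓝[>] (0 : ℝ), Inner (γ t) := by
      filter_upwards [Ioc_mem_nhdsGT (zero_lt_one (α := ℝ))] with t ht using hγin t ht
    have t1 : Tendsto (fun t => F (γ t)) (𝓝[>] 0) (𝓝 (F p)) := by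
      refine (hcont p ⟨hp, hp1⟩).tendsto.comp (tendsto_nhdsWithin_iff.2 ⟨hγt, ?_⟩)
      filter_upwards [hev] with t ht using ⟨fun i => (ht.1 i).le, ht.2⟩
    have hG : Continuous fun q : Fin n → ℝ => c * (∑ i, q i * Real.log (q i)) + A q := by
      simp only [hA]
      have : ∀ i : Fin n, Continuous fun q : Fin n → ℝ => q i * Real.log (q i) :=
        fun i => Real.continuous_mul_log.comp (continuous_apply i)
      fun_prop
    have t2 := (hG.tendsto p).comp hγt
    refine tendsto_nhds_unique t1 (t2.congr' ?_)
    filter_upwards [hev] with t ht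
    exact (hFin _ ht).symm
  refine ⟨c, A.toAffineMap, ?_, hall⟩
  rcases hc0.eq_or_lt with h0 | h0
  swap
  · exact h0
  exfalso
  have v0 : (Pi.single i0 1 : Fin n → ℝ) ∈
      {p : Fin n → ℝ | (∀ i, 0 ≤ p i) ∧ ∑ i, p i = 1} :=
    ⟨fun k => by by_cases hk : k = i0 <;> simp [Pi.single_apply, hk], by simp⟩
  have v1 : (Pi.single i1 1 : Fin n → ℝ) ∈
      {p : Fin n → ℝ | (∀ i, 0 ≤ p i) ∧ ∑ i, p i = 1} :=
    ⟨fun k => by by_cases hk : k = i1 <;> simp [Pi.single_apply, hk], by simp⟩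
  have hne : (Pi.single i0 1 : Fin n → ℝ) ≠ Pi.single i1 1 := by
    intro h
    have := congrFun h i0
    simp [hi01] at this
  have hs := hconv.2 v0 v1 hne (half_pos one_pos) (half_pos one_pos) (add_halves 1)
  have vm := hconv.1 v0 v1 (half_pos (one_pos (α := ℝ))).le (half_pos (one_pos (α := ℝ))).le (add_halves 1)
  rw [hall _ vm.1 vm.2, hall _ v0.1 v0.2, hall _ v1.1 v1.2, ← h0] at hs
  simp only [zero_mul, zero_add, map_add, map_smul, lt_irrefl] at hs
end
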